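/- arXiv:1506.07488 — 6 statements merged into one kernel-verified Lean document; each statement's English description precedes it below -/
import Mathlib

section
/- Let 0 < u, v < 1 with u ≠ v. Then, as ε → 0+, ⟨f⁽¹⁾_{ε,u}, f⁽¹⁾_{ε,v}⟩ = −(1/(2π²))·(log ε − κ + log|u−v| − log u − log v) + O(ε); precisely, there exist constants C > 0 and ε₀ > 0 (depending on φ, u, v) such that for all 0 < ε < ε₀ one has |⟨f⁽¹⁾_{ε,u}, f⁽¹⁾_{ε,v}⟩ + (1/(2π²))·(log ε − κ + log|u−v| − log u − log v)| ≤ C·ε. -/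
open MeasureTheory Real Set

/-- The scalar product ⟨f,g⟩ = −(1/(2π²)) ∬ f′(x) g′(y) log|x−y| dx dy. -/
noncomputable def scalarProd (f g : ℝ → ℝ) : ℝ :=
  -(1 / (2 * π ^ 2)) * ∫ x : ℝ, ∫ y : ℝ, deriv f x * deriv g y * Real.log |x - y|

/-- κ = −∬ φ(x) φ(y) log|x−y| dx dy. -/
noncomputable def kappa (φ : ℝ → ℝ) : ℝ :=
  -∫ x : ℝ, ∫ y : ℝ, φ x * φ y * Real.log |x - y|

/-- The smoothed indicator function χ_J ⋆ φ_ε, where φ_ε(x) = ε⁻¹ φ(x/ε). -/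
noncomputable def smoothedInd (φ : ℝ → ℝ) (ε : ℝ) (J : Set ℝ) (x : ℝ) : ℝ :=
  ∫ y : ℝ, J.indicator (fun _ => (1 : ℝ)) (x - y) * (ε⁻¹ * φ (y / ε))

/-- The logarithmic potential `x ↦ ∫ g(y) log|x - y| dy` of a density `g`. -/
noncomputable def logPotential (g : ℝ → ℝ) (x : ℝ) : ℝ :=
  ∫ y : ℝ, g y * Real.log |x - y|

/-- The rescaled bump `x ↦ ε⁻¹ φ((x - a)/ε)` centred at `a`. -/
noncomputable def rescale (φ : ℝ → ℝ) (ε a x : ℝ) : ℝ := ε⁻¹ * φ ((x - a) / ε)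

/-- The logarithmic energy `∬ f(x) g(y) log|x - y| dx dy`. -/
noncomputable def logEnergy (f g : ℝ → ℝ) : ℝ := ∫ x : ℝ, f x * logPotential g x

theorem integral_integral_mul_log_eq_logEnergy (f g : ℝ → ℝ) :
    ∫ x : ℝ, ∫ y : ℝ, f x * g y * Real.log |x - y| = logEnergy f g := by
  simp only [logEnergy, logPotential, mul_assoc, integral_const_mul]

theorem locallyIntegrable_log : LocallyIntegrable Real.log := by
  rw [locallyIntegrable_iff]
  intro K hK
  obtain ⟨r, hr⟩ := hK.isBounded.subset_closedBall 0
  rw [Real.closedBall_eq_Icc] at hr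
  have h : IntervalIntegrable Real.log volume (0 - r) (0 + r) :=
    intervalIntegral.intervalIntegrable_log'
  by_cases hr0 : 0 - r ≤ 0 + r
  · exact ((intervalIntegrable_iff_integrableOn_Icc_of_le hr0).1 h).mono_set hr
  · rw [Set.Icc_eq_empty hr0] at hr
    rw [Set.subset_empty_iff.1 hr]
    exact integrableOn_empty

section Energy

variable {f g h : ℝ → ℝ}

theorem integrable_mul_log (hg : Continuous g) (hgs : HasCompactSupport g) (x : ℝ) :
    Integrable fun y => g y * Real.log |x - y| := by
  have := hgs.convolutionExists_left (ContinuousLinearMap.mul ℝ ℝ) hg locallyIntegrable_log x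
  simpa [ConvolutionExistsAt] using this

theorem continuous_logPotential (hg : Continuous g) (hgs : HasCompactSupport g) :
    Continuous (logPotential g) := by
  have := hgs.continuous_convolution_left (ContinuousLinearMap.mul ℝ ℝ) hg locallyIntegrable_log
  convert this using 1
  ext x
  simp [logPotential, convolution]

theorem integrable_mul_logPotential (hf : Continuous f) (hfs : HasCompactSupport f)
    (hg : Continuous g) (hgs : HasCompactSupport g) :
    Integrable fun x => f x * logPotential g x :=
  (hf.mul (continuous_logPotential hg hgs)).integrable_of_hasCompactSupport hfs.mul_right

theorem logPotential_sub (hg : Continuous g) (hgs : HasCompactSupport g)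
    (hh : Continuous h) (hhs : HasCompactSupport h) (x : ℝ) :
    logPotential (fun y => g y - h y) x = logPotential g x - logPotential h x := by
  simp only [logPotential, sub_mul]
  exact integral_sub (integrable_mul_log hg hgs x) (integrable_mul_log hh hhs x)

theorem logEnergy_sub_left (hf : Continuous f) (hfs : HasCompactSupport f)
    (hg : Continuous g) (hgs : HasCompactSupport g)
    (hh : Continuous h) (hhs : HasCompactSupport h) :
    logEnergy (fun x => f x - g x) h = logEnergy f h - logEnergy g h := by
  simp only [logEnergy, sub_mul]
  exact integral_sub (integrable_mul_logPotential hf hfs hh hhs)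
    (integrable_mul_logPotential hg hgs hh hhs)

theorem logEnergy_sub_right (hf : Continuous f) (hfs : HasCompactSupport f)
    (hg : Continuous g) (hgs : HasCompactSupport g)
    (hh : Continuous h) (hhs : HasCompactSupport h) :
    logEnergy f (fun y => g y - h y) = logEnergy f g - logEnergy f h := by
  simp only [logEnergy, logPotential_sub hg hgs hh hhs, mul_sub]
  exact integral_sub (integrable_mul_logPotential hf hfs hg hgs)
    (integrable_mul_logPotential hf hfs hh hhs)

/-- If the kernel `log|x - y|` is `δ`-close to `l` on the supports of two densities of mass one,
then their logarithmic energy is close to `l`. -/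
theorem abs_logEnergy_sub_le (hf : Continuous f) (hfs : HasCompactSupport f)
    (hg : Continuous g) (hgs : HasCompactSupport g)
    (hf1 : ∫ x, f x = 1) (hg1 : ∫ x, g x = 1) {l δ : ℝ}
    (hδ : ∀ x y, f x ≠ 0 → g y ≠ 0 → |Real.log |x - y| - l| ≤ δ) :
    |logEnergy f g - l| ≤ δ * (∫ x, |f x|) * ∫ y, |g y| := by
  have hfi : Integrable f := hf.integrable_of_hasCompactSupport hfs
  have hgi : Integrable g := hg.integrable_of_hasCompactSupport hgs
  have hpot : ∀ x, f x ≠ 0 → |logPotential g x - l| ≤ δ * ∫ y, |g y| := by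
    intro x hx
    have heq : logPotential g x - l = ∫ y, g y * (Real.log |x - y| - l) := by
      simp only [mul_sub]
      rw [integral_sub (integrable_mul_log hg hgs x) (hgi.mul_const l), integral_mul_const, hg1,
        one_mul, logPotential]
    rw [heq, ← integral_const_mul, ← Real.norm_eq_abs]
    refine norm_integral_le_of_norm_le (hgi.abs.const_mul δ) (Filter.Eventually.of_forall ?_)
    intro y
    rw [Real.norm_eq_abs, abs_mul, mul_comm]
    by_cases hy : g y = 0
    · simp [hy]
    · exact mul_le_mul_of_nonneg_right (hδ x y hx hy) (abs_nonneg _)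
  have heq : logEnergy f g - l = ∫ x, f x * (logPotential g x - l) := by
    simp only [mul_sub]
    rw [integral_sub (integrable_mul_logPotential hf hfs hg hgs) (hfi.mul_const l),
      integral_mul_const, hf1, one_mul, logEnergy]
  rw [heq, mul_right_comm, ← integral_const_mul, ← Real.norm_eq_abs]
  refine norm_integral_le_of_norm_le (hfi.abs.const_mul _) (Filter.Eventually.of_forall ?_)
  intro x
  rw [Real.norm_eq_abs, abs_mul, mul_comm]
  by_cases hx : f x = 0
  · simp [hx]
  · exact mul_le_mul_of_nonneg_right (hpot x hx) (abs_nonneg _)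

end Energy

section Rescale

variable {φ : ℝ → ℝ} {ε : ℝ}

theorem continuous_rescale (hφ : Continuous φ) (a : ℝ) : Continuous (rescale φ ε a) := by
  unfold rescale
  fun_prop

theorem abs_sub_lt_of_rescale_ne_zero (hsupp : Function.support φ ⊆ Set.Ioo (-(1/2)) (1/2))
    (hε : 0 < ε) {a x : ℝ} (hx : rescale φ ε a x ≠ 0) : |x - a| < ε / 2 := by
  have h : (x - a) / ε ∈ Set.Ioo (-(1/2) : ℝ) (1/2) := hsupp (right_ne_zero_of_mul hx)
  obtain ⟨h1, h2⟩ := h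
  rw [lt_div_iff₀ hε] at h1
  rw [div_lt_iff₀ hε] at h2
  rw [abs_lt]
  constructor <;> linarith

theorem hasCompactSupport_rescale (hsupp : Function.support φ ⊆ Set.Ioo (-(1/2)) (1/2))
    (hε : 0 < ε) (a : ℝ) : HasCompactSupport (rescale φ ε a) := by
  refine HasCompactSupport.of_support_subset_isCompact (isCompact_closedBall a (ε / 2)) ?_
  intro x hx
  rw [Metric.mem_closedBall, Real.dist_eq]
  exact (abs_sub_lt_of_rescale_ne_zero hsupp hε hx).le

theorem integral_comp_rescale (hε : 0 < ε) (a : ℝ) (F : ℝ → ℝ) :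
    ∫ x, ε⁻¹ * F ((x - a) / ε) = ∫ s, F s := by
  rw [integral_const_mul, integral_sub_right_eq_self (fun x => F (x / ε)) a,
    Measure.integral_comp_div, smul_eq_mul, abs_of_pos hε, inv_mul_cancel_left₀ hε.ne']

theorem integral_rescale (hε : 0 < ε) (a : ℝ) : ∫ x, rescale φ ε a x = ∫ s, φ s :=
  integral_comp_rescale hε a φ

theorem integral_abs_rescale (hε : 0 < ε) (a : ℝ) :
    ∫ x, |rescale φ ε a x| = ∫ s, |φ s| := by
  simp only [rescale, abs_mul, abs_of_pos (inv_pos.2 hε)]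
  exact integral_comp_rescale hε a fun s => |φ s|

theorem logPotential_rescale (hφ : Continuous φ) (hφs : HasCompactSupport φ) (hε : 0 < ε)
    (a x : ℝ) :
    logPotential (rescale φ ε a) x =
      (∫ t, φ t) * Real.log ε + logPotential φ ((x - a) / ε) := by
  have h : logPotential (rescale φ ε a) x
      = ∫ y, ε⁻¹ * (fun t => φ t * Real.log |x - a - ε * t|) ((y - a) / ε) := by
    refine integral_congr_ae (Filter.Eventually.of_forall fun y => ?_)
    have : x - a - ε * ((y - a) / ε) = x - y := by field_simp; ring
    simp only [rescale, this, mul_assoc]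
  rw [h, integral_comp_rescale hε a fun t => φ t * Real.log |x - a - ε * t|, logPotential,
    ← integral_mul_const, ← integral_add
      ((hφ.integrable_of_hasCompactSupport hφs).mul_const _) (integrable_mul_log hφ hφs _)]
  refine integral_congr_ae ?_
  filter_upwards [(Set.countable_singleton ((x - a) / ε)).ae_notMem volume] with t ht
  have ht' : (x - a) / ε - t ≠ 0 := sub_ne_zero.2 (Ne.symm ht)
  have hfac : x - a - ε * t = ε * ((x - a) / ε - t) := by field_simp
  rw [hfac, abs_mul, abs_of_pos hε, Real.log_mul hε.ne' (abs_ne_zero.2 ht'), mul_add]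

theorem logEnergy_rescale_self (hφ : Continuous φ) (hφs : HasCompactSupport φ)
    (hnorm : ∫ x, φ x = 1) (hε : 0 < ε) (a : ℝ) :
    logEnergy (rescale φ ε a) (rescale φ ε a) = Real.log ε - kappa φ := by
  have h : logEnergy (rescale φ ε a) (rescale φ ε a)
      = ∫ x, ε⁻¹ * (fun s => φ s * (Real.log ε + logPotential φ s)) ((x - a) / ε) := by
    simp only [logEnergy, logPotential_rescale hφ hφs hε, hnorm, one_mul, rescale, mul_assoc]
  rw [h, integral_comp_rescale hε a fun s => φ s * (Real.log ε + logPotential φ s)]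
  simp only [mul_add]
  rw [integral_add ((hφ.integrable_of_hasCompactSupport hφs).mul_const _)
    (integrable_mul_logPotential hφ hφs hφ hφs), integral_mul_const, hnorm, one_mul, kappa,
    integral_integral_mul_log_eq_logEnergy, sub_neg_eq_add, logEnergy]

theorem abs_log_abs_sub_log_abs_le {z w η : ℝ} (hw : w ≠ 0) (hη : η ≤ |w| / 2)
    (h : |z - w| ≤ η) : |(Real.log |z| - Real.log |w|)| ≤ 2 * η / |w| := by
  have hw0 : 0 < |w| := abs_pos.2 hw
  have hη0 : 0 ≤ η := (abs_nonneg _).trans h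
  have h1 : |z| - |w| ≤ η := (abs_sub_abs_le_abs_sub z w).trans h
  have h2 : |w| - |z| ≤ η := (abs_sub_abs_le_abs_sub w z).trans (abs_sub_comm z w ▸ h)
  have hz0 : 0 < |z| := by linarith
  have h3 := Real.log_le_sub_one_of_pos (div_pos hz0 hw0)
  have h4 := Real.log_le_sub_one_of_pos (div_pos hw0 hz0)
  rw [Real.log_div hz0.ne' hw0.ne'] at h3
  rw [Real.log_div hw0.ne' hz0.ne'] at h4
  have h5 : |z| / |w| - 1 ≤ 2 * η / |w| := by
    rw [div_sub_one hw0.ne']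
    gcongr
    linarith
  have h6 : |w| / |z| - 1 ≤ 2 * η / |w| := by
    rw [div_sub_one hz0.ne', div_le_div_iff₀ hz0 hw0]
    nlinarith
  rw [abs_le]
  constructor <;> linarith

theorem abs_logEnergy_rescale_sub_log_le (hφ : Continuous φ)
    (hsupp : Function.support φ ⊆ Set.Ioo (-(1/2)) (1/2)) (hnorm : ∫ x, φ x = 1)
    (hε : 0 < ε) {a b : ℝ} (hab : a ≠ b) (hεab : ε ≤ |a - b| / 2) :
    |(logEnergy (rescale φ ε a) (rescale φ ε b) - Real.log |a - b|)| ≤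
      2 * ε / |a - b| * (∫ s, |φ s|) * ∫ s, |φ s| := by
  have h := abs_logEnergy_sub_le (f := rescale φ ε a) (g := rescale φ ε b)
    (l := Real.log |a - b|) (δ := 2 * ε / |a - b|)
    (continuous_rescale hφ a) (hasCompactSupport_rescale hsupp hε a)
    (continuous_rescale hφ b) (hasCompactSupport_rescale hsupp hε b)
    ((integral_rescale hε a).trans hnorm) ((integral_rescale hε b).trans hnorm) ?_
  · rwa [integral_abs_rescale hε, integral_abs_rescale hε] at h
  · intro x y hx hy
    have hxa := abs_lt.1 (abs_sub_lt_of_rescale_ne_zero hsupp hε hx)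
    have hyb := abs_lt.1 (abs_sub_lt_of_rescale_ne_zero hsupp hε hy)
    refine abs_log_abs_sub_log_abs_le (sub_ne_zero.2 hab) hεab (abs_le.2 ⟨?_, ?_⟩) <;> linarith

theorem deriv_smoothedInd_Icc (hφ : Continuous φ) {u : ℝ} (hu : 0 ≤ u) :
    deriv (smoothedInd φ ε (Set.Icc 0 u)) = fun x => rescale φ ε 0 x - rescale φ ε u x := by
  have hc : Continuous (rescale φ ε 0) := continuous_rescale hφ 0
  have hF : ∀ x, HasDerivAt (fun z => ∫ y in (0 : ℝ)..z, rescale φ ε 0 y) (rescale φ ε 0 x) x :=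
    fun x => intervalIntegral.integral_hasDerivAt_right (hc.intervalIntegrable _ _)
      (hc.stronglyMeasurableAtFilter _ _) hc.continuousAt
  have heq : smoothedInd φ ε (Set.Icc 0 u) = fun x =>
      (∫ y in (0 : ℝ)..x, rescale φ ε 0 y) - ∫ y in (0 : ℝ)..(x - u), rescale φ ε 0 y := by
    ext x
    rw [intervalIntegral.integral_interval_sub_left (hc.intervalIntegrable _ _)
      (hc.intervalIntegrable _ _), intervalIntegral.integral_of_le (by linarith),
      ← integral_Icc_eq_integral_Ioc, ← integral_indicator measurableSet_Icc]
    refine integral_congr_ae (Filter.Eventually.of_forall fun y => ?_)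
    have hiff : x - y ∈ Set.Icc 0 u ↔ y ∈ Set.Icc (x - u) x := by
      constructor <;> rintro ⟨h1, h2⟩ <;> constructor <;> linarith
    by_cases hy : y ∈ Set.Icc (x - u) x
    · simp only [Set.indicator_of_mem hy, Set.indicator_of_mem (hiff.2 hy), rescale, one_mul,
        sub_zero]
    · simp only [Set.indicator_of_notMem hy, Set.indicator_of_notMem (mt hiff.1 hy), zero_mul]
  ext x
  have h := (hF x).sub ((hF (x - u)).comp_sub_const x u)
  rw [heq]
  refine h.deriv.trans ?_
  simp only [rescale, sub_zero]

end Rescale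

theorem stmt_0 (φ : ℝ → ℝ) (hφ : ContDiff ℝ (⊤ : ℕ∞) φ)
    (hsupp : Function.support φ ⊆ Set.Ioo (-(1/2)) (1/2))
    (hnorm : ∫ x : ℝ, φ x = 1)
    (u v : ℝ) (hu0 : 0 < u) (hu1 : u < 1) (hv0 : 0 < v) (hv1 : v < 1) (huv : u ≠ v) :
    ∃ C > 0, ∃ ε₀ > 0, ∀ ε : ℝ, 0 < ε → ε < ε₀ →
      |scalarProd (smoothedInd φ ε (Set.Icc 0 u)) (smoothedInd φ ε (Set.Icc 0 v)) +
        (1 / (2 * π ^ 2)) *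
          (Real.log ε - kappa φ + Real.log |u - v| - Real.log u - Real.log v)| ≤ C * ε := by
  have hc : Continuous φ := hφ.continuous
  have hφs : HasCompactSupport φ :=
    HasCompactSupport.of_support_subset_isCompact isCompact_Icc
      (hsupp.trans Set.Ioo_subset_Icc_self)
  set M := ∫ s, |φ s| with hM
  have hd : 0 < |u - v| := abs_pos.2 (sub_ne_zero.2 huv)
  have hπ : 0 < 1 / (2 * π ^ 2) := by positivity
  refine ⟨1 / (2 * π ^ 2) * (2 * M ^ 2 * (1 / u + 1 / v + 1 / |u - v|)) + 1, by positivity,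
    min (min u v) (|u - v|) / 2, by positivity, fun ε hε hε₀ => ?_⟩
  have hεu : ε ≤ |u - 0| / 2 := by
    have := (min_le_left (min u v) (|u - v|)).trans (min_le_left u v)
    rw [sub_zero, abs_of_pos hu0]
    linarith
  have hεv : ε ≤ |0 - v| / 2 := by
    have := (min_le_left (min u v) (|u - v|)).trans (min_le_right u v)
    rw [zero_sub, abs_neg, abs_of_pos hv0]
    linarith
  have hεuv : ε ≤ |u - v| / 2 := by
    have := min_le_right (min u v) (|u - v|)
    linarith
  have h0 := logEnergy_rescale_self hc hφs hnorm hε 0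
  have h1 := abs_logEnergy_rescale_sub_log_le hc hsupp hnorm hε hu0.ne' hεu
  have h2 := abs_logEnergy_rescale_sub_log_le hc hsupp hnorm hε hv0.ne hεv
  have h3 := abs_logEnergy_rescale_sub_log_le hc hsupp hnorm hε huv hεuv
  rw [sub_zero, abs_of_pos hu0, ← hM] at h1
  rw [zero_sub, abs_neg, abs_of_pos hv0, ← hM] at h2
  rw [← hM] at h3
  have hcont := fun a => continuous_rescale (ε := ε) hc a
  have hcs := fun a => hasCompactSupport_rescale hsupp hε a
  rw [scalarProd, deriv_smoothedInd_Icc hc hu0.le, deriv_smoothedInd_Icc hc hv0.le,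
    integral_integral_mul_log_eq_logEnergy,
    logEnergy_sub_left (h := fun x => rescale φ ε 0 x - rescale φ ε v x)
      (hcont 0) (hcs 0) (hcont u) (hcs u)
      ((hcont 0).sub (hcont v)) ((hcs 0).sub (hcs v)),
    logEnergy_sub_right (hcont 0) (hcs 0) (hcont 0) (hcs 0) (hcont v) (hcs v),
    logEnergy_sub_right (hcont u) (hcs u) (hcont 0) (hcs 0) (hcont v) (hcs v), h0]
  set A := logEnergy (rescale φ ε u) (rescale φ ε 0)
  set B := logEnergy (rescale φ ε 0) (rescale φ ε v)
  set D := logEnergy (rescale φ ε u) (rescale φ ε v)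
  have hsum : |(A - Real.log u) + (B - Real.log v) - (D - Real.log |u - v|)| ≤
      2 * M ^ 2 * (1 / u + 1 / v + 1 / |u - v|) * ε :=
    calc _ ≤ |A - Real.log u| + |B - Real.log v| + |(D - Real.log |u - v|)| :=
          (abs_sub _ _).trans (add_le_add_left (abs_add_le _ _) _)
      _ ≤ _ := add_le_add (add_le_add h1 h2) h3
      _ = _ := by ring
  calc _ = |1 / (2 * π ^ 2) *
        ((A - Real.log u) + (B - Real.log v) - (D - Real.log |u - v|))| := by
        congr 1
        ring
    _ ≤ 1 / (2 * π ^ 2) * (2 * M ^ 2 * (1 / u + 1 / v + 1 / |u - v|) * ε) := by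
        rw [abs_mul, abs_of_pos hπ]
        exact mul_le_mul_of_nonneg_left hsum hπ.le
    _ ≤ _ := by linarith
end

section
/- Let 0 < u, v < 1 with u ≠ v. Then, as ε → 0+, ⟨f⁽²⁾_{ε,u}, f⁽²⁾_{ε,v}⟩ = −(1/(2π²))·(3·log ε − κ + log|u−v|) + O(ε); precisely, there exist constants C > 0 and ε₀ > 0 (depending on φ, u, v) such that for all 0 < ε < ε₀ one has |⟨f⁽²⁾_{ε,u}, f⁽²⁾_{ε,v}⟩ + (1/(2π²))·(3·log ε − κ + log|u−v|)| ≤ C·ε. -/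
open MeasureTheory Real Set

/-- The bump function `φ` rescaled to width `ε` and centred at `a`. -/
noncomputable def scaledBump (φ : ℝ → ℝ) (ε a x : ℝ) : ℝ := ε⁻¹ * φ ((x - a) / ε)

/-- The logarithmic energy pairing of two functions. -/
noncomputable def logPairing (f g : ℝ → ℝ) : ℝ :=
  ∫ x : ℝ, f x * ∫ y : ℝ, g y * Real.log |x - y|

theorem locallyIntegrable_log_abs : LocallyIntegrable (fun t : ℝ => Real.log |t|) := by
  simp only [Real.log_abs]
  rw [locallyIntegrable_iff]
  intro k hk
  obtain ⟨R, hR⟩ := hk.isBounded.subset_closedBall 0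
  rw [Real.closedBall_eq_Icc] at hR
  have h : IntervalIntegrable Real.log volume (0 - R) (0 + R) :=
    intervalIntegral.intervalIntegrable_log'
  by_cases hab : 0 - R ≤ 0 + R
  · rw [intervalIntegrable_iff_integrableOn_Icc_of_le hab] at h
    exact h.mono_set hR
  · rw [Set.Icc_eq_empty hab] at hR
    exact integrableOn_empty.mono_set hR

theorem integrable_mul_log_abs_sub {g : ℝ → ℝ} (hg : Continuous g) (hgs : HasCompactSupport g)
    (x : ℝ) : Integrable (fun y => g y * Real.log |x - y|) :=
  hgs.convolutionExists_left (ContinuousLinearMap.mul ℝ ℝ) hg locallyIntegrable_log_abs x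

theorem continuous_integral_mul_log_abs_sub {g : ℝ → ℝ} (hg : Continuous g)
    (hgs : HasCompactSupport g) : Continuous fun x => ∫ y : ℝ, g y * Real.log |x - y| :=
  hgs.continuous_convolution_left (ContinuousLinearMap.mul ℝ ℝ) hg locallyIntegrable_log_abs

theorem integrable_mul_integral_mul_log {f g : ℝ → ℝ} (hf : Continuous f)
    (hfs : HasCompactSupport f) (hg : Continuous g) (hgs : HasCompactSupport g) :
    Integrable (fun x => f x * ∫ y : ℝ, g y * Real.log |x - y|) :=
  (hf.mul (continuous_integral_mul_log_abs_sub hg hgs)).integrable_of_hasCompactSupport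
    hfs.mul_right

theorem logPairing_sub_left {f₁ f₂ g : ℝ → ℝ} (hf₁ : Continuous f₁)
    (hfs₁ : HasCompactSupport f₁) (hf₂ : Continuous f₂) (hfs₂ : HasCompactSupport f₂)
    (hg : Continuous g) (hgs : HasCompactSupport g) :
    logPairing (fun x => f₁ x - f₂ x) g = logPairing f₁ g - logPairing f₂ g := by
  simp only [logPairing, sub_mul]
  exact integral_sub (integrable_mul_integral_mul_log hf₁ hfs₁ hg hgs)
    (integrable_mul_integral_mul_log hf₂ hfs₂ hg hgs)

theorem logPairing_sub_right {f g₁ g₂ : ℝ → ℝ} (hf : Continuous f)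
    (hfs : HasCompactSupport f) (hg₁ : Continuous g₁) (hgs₁ : HasCompactSupport g₁)
    (hg₂ : Continuous g₂) (hgs₂ : HasCompactSupport g₂) :
    logPairing f (fun x => g₁ x - g₂ x) = logPairing f g₁ - logPairing f g₂ := by
  simp only [logPairing]
  rw [← integral_sub (integrable_mul_integral_mul_log hf hfs hg₁ hgs₁)
    (integrable_mul_integral_mul_log hf hfs hg₂ hgs₂)]
  congr 1 with x
  rw [← mul_sub, ← integral_sub (integrable_mul_log_abs_sub hg₁ hgs₁ x)
    (integrable_mul_log_abs_sub hg₂ hgs₂ x)]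
  simp only [sub_mul]

/-- If the logarithmic kernel is within `b` of `c` on the supports of two functions of unit
mass, then so is their pairing, up to the product of their `L¹` norms. -/
theorem abs_logPairing_sub_le {f g : ℝ → ℝ} (hf : Continuous f)
    (hfs : HasCompactSupport f) (hg : Continuous g) (hgs : HasCompactSupport g)
    (hf1 : ∫ x, f x = 1) (hg1 : ∫ x, g x = 1) {b c : ℝ}
    (h : ∀ x y, f x ≠ 0 → g y ≠ 0 → |Real.log |x - y| - c| ≤ b) :
    |logPairing f g - c| ≤ b * (∫ x, |f x|) * ∫ x, |g x| := by
  have hfi := hf.integrable_of_hasCompactSupport (μ := volume) hfs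
  have hgi := hg.integrable_of_hasCompactSupport (μ := volume) hgs
  have hc : logPairing f g - c
      = ∫ x, f x * ((∫ y, g y * Real.log |x - y|) - c) := by
    simp only [mul_sub]
    rw [integral_sub (integrable_mul_integral_mul_log hf hfs hg hgs) (hfi.mul_const c),
      integral_mul_const, hf1, one_mul, logPairing]
  rw [hc]
  have hin : ∀ x, f x ≠ 0 → |(∫ y, g y * Real.log |x - y|) - c| ≤ b * ∫ y, |g y| := by
    intro x hx
    have hi : (∫ y, g y * Real.log |x - y|) - c = ∫ y, g y * (Real.log |x - y| - c) := by
      simp only [mul_sub]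
      rw [integral_sub (integrable_mul_log_abs_sub hg hgs x) (hgi.mul_const c),
        integral_mul_const, hg1, one_mul]
    rw [hi, ← integral_const_mul, ← Real.norm_eq_abs]
    refine norm_integral_le_of_norm_le (hgi.abs.const_mul b) (.of_forall fun y => ?_)
    rw [Real.norm_eq_abs, abs_mul, mul_comm]
    rcases eq_or_ne (g y) 0 with hy | hy
    · simp [hy]
    · exact mul_le_mul_of_nonneg_right (h x y hx hy) (abs_nonneg _)
  have hR : b * (∫ x, |f x|) * ∫ x, |g x| = ∫ x, (b * ∫ y, |g y|) * |f x| := by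
    rw [integral_const_mul]; ring
  rw [hR, ← Real.norm_eq_abs]
  refine norm_integral_le_of_norm_le (hfi.abs.const_mul _) (.of_forall fun x => ?_)
  rw [Real.norm_eq_abs, abs_mul, mul_comm]
  rcases eq_or_ne (f x) 0 with hx | hx
  · simp [hx]
  · exact mul_le_mul_of_nonneg_right (hin x hx) (abs_nonneg _)

theorem abs_log_one_add_le {w : ℝ} (hw : |w| ≤ 1 / 2) : |Real.log (1 + w)| ≤ 2 * |w| := by
  obtain ⟨h1, h2⟩ := abs_le.mp hw
  have hpos : 0 < 1 + w := by linarith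
  have hup := Real.log_le_sub_one_of_pos hpos
  have hlow := Real.one_sub_inv_le_log_of_pos hpos
  have hfrac : -(2 * |w|) ≤ 1 - (1 + w)⁻¹ := by
    have he : 1 - (1 + w)⁻¹ = w / (1 + w) := by field_simp; ring
    rw [he, le_div_iff₀ hpos]
    rcases abs_cases w with ⟨h, _⟩ | ⟨h, _⟩ <;> rw [h] <;> nlinarith
  exact abs_le.mpr ⟨by linarith, by linarith [le_abs_self w, abs_nonneg w]⟩

theorem abs_log_abs_add_sub_le {d e : ℝ} (hd : d ≠ 0) (he : |e| ≤ |d| / 2) :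
    |Real.log |d + e| - Real.log (|d|)| ≤ 2 * (|e| / |d|) := by
  have hd' : 0 < |d| := abs_pos.mpr hd
  have hw : |e / d| ≤ 1 / 2 := by
    rw [abs_div, div_le_iff₀ hd']; linarith
  have hne : 1 + e / d ≠ 0 := by
    have := (abs_le.mp hw).1
    linarith
  have hfac : d + e = d * (1 + e / d) := by field_simp
  rw [hfac, Real.log_abs, Real.log_abs, Real.log_mul hd hne, add_sub_cancel_left, ← abs_div]
  exact abs_log_one_add_le hw

section scaledBump

variable {φ : ℝ → ℝ} {ε : ℝ}

theorem continuous_scaledBump (hφ : Continuous φ) (a : ℝ) :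
    Continuous (scaledBump φ ε a) := by
  unfold scaledBump
  fun_prop

theorem abs_sub_lt_of_scaledBump_ne_zero
    (hsupp : Function.support φ ⊆ Set.Ioo (-(1/2)) (1/2)) (hε : 0 < ε) {a x : ℝ}
    (hx : scaledBump φ ε a x ≠ 0) : |x - a| < ε / 2 := by
  have h := hsupp (Function.mem_support.mpr (right_ne_zero_of_mul hx))
  rw [Set.mem_Ioo, lt_div_iff₀ hε, div_lt_iff₀ hε] at h
  exact abs_lt.mpr ⟨by linarith [h.1], by linarith [h.2]⟩

theorem hasCompactSupport_scaledBump
    (hsupp : Function.support φ ⊆ Set.Ioo (-(1/2)) (1/2)) (hε : 0 < ε) (a : ℝ) :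
    HasCompactSupport (scaledBump φ ε a) :=
  HasCompactSupport.of_support_subset_isCompact (isCompact_closedBall a (ε / 2)) fun _ hx => by
    rw [Metric.mem_closedBall, Real.dist_eq]
    exact (abs_sub_lt_of_scaledBump_ne_zero hsupp hε hx).le

theorem integral_scaledBump_mul (hε : 0 < ε) (a : ℝ) (F : ℝ → ℝ) :
    ∫ x, scaledBump φ ε a x * F x = ∫ s, φ s * F (a + ε * s) := by
  have h := Measure.integral_comp_div (fun s => φ s * F (a + ε * s)) ε
  rw [← integral_sub_right_eq_self _ a, abs_of_pos hε, smul_eq_mul] at h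
  rw [← inv_mul_cancel_left₀ hε.ne' (∫ s, φ s * F (a + ε * s)), ← h, ← integral_const_mul]
  congr 1 with x
  rw [scaledBump, mul_div_cancel₀ _ hε.ne', add_sub_cancel, mul_assoc]

theorem integral_scaledBump (hε : 0 < ε) (a : ℝ) :
    ∫ x, scaledBump φ ε a x = ∫ s, φ s := by
  simpa using integral_scaledBump_mul (φ := φ) hε a fun _ => 1

theorem integral_abs_scaledBump (hε : 0 < ε) (a : ℝ) :
    ∫ x, |scaledBump φ ε a x| = ∫ s, |φ s| := by
  rw [← integral_scaledBump (φ := fun s => |φ s|) hε a]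
  simp only [scaledBump, abs_mul, abs_of_pos (inv_pos.mpr hε)]

theorem kappa_eq_neg_logPairing (φ : ℝ → ℝ) : kappa φ = -logPairing φ φ := by
  simp only [kappa, logPairing, mul_assoc, integral_const_mul]

theorem logPairing_scaledBump_self (hφ : Continuous φ) (hφs : HasCompactSupport φ)
    (hnorm : ∫ x, φ x = 1) (hε : 0 < ε) (a : ℝ) :
    logPairing (scaledBump φ ε a) (scaledBump φ ε a) = Real.log ε - kappa φ := by
  have hi := hφ.integrable_of_hasCompactSupport (μ := volume) hφs
  rw [kappa_eq_neg_logPairing, sub_neg_eq_add, logPairing,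
    integral_scaledBump_mul hε a fun x => ∫ y, scaledBump φ ε a y * Real.log |x - y|]
  have hinner : ∀ s, (∫ y, scaledBump φ ε a y * Real.log |a + ε * s - y|)
      = Real.log ε + ∫ t, φ t * Real.log |s - t| := by
    intro s
    rw [integral_scaledBump_mul hε a fun y => Real.log |a + ε * s - y|]
    have hae : (fun t => φ t * Real.log |a + ε * s - (a + ε * t)|) =ᵐ[volume]
        fun t => φ t * Real.log ε + φ t * Real.log |s - t| := by
      filter_upwards [compl_mem_ae_iff.mpr (measure_singleton (μ := volume) s)] with t ht
      have hst : s - t ≠ 0 := sub_ne_zero.mpr fun h => ht h.symm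
      rw [show a + ε * s - (a + ε * t) = ε * (s - t) by ring, Real.log_abs, Real.log_abs,
        Real.log_mul hε.ne' hst, mul_add]
    rw [integral_congr_ae hae, integral_add (hi.mul_const _)
      (integrable_mul_log_abs_sub hφ hφs s), integral_mul_const, hnorm, one_mul]
  simp only [hinner, mul_add]
  rw [integral_add (hi.mul_const _) (integrable_mul_integral_mul_log hφ hφs hφ hφs),
    integral_mul_const, hnorm, one_mul, logPairing]

theorem abs_logPairing_scaledBump_sub_log_le (hφ : Continuous φ)
    (hsupp : Function.support φ ⊆ Set.Ioo (-(1/2)) (1/2)) (hnorm : ∫ x, φ x = 1) (hε : 0 < ε)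
    {a b : ℝ} (hab : 2 * ε ≤ |a - b|) :
    |logPairing (scaledBump φ ε a) (scaledBump φ ε b) - Real.log (|a - b|)|
      ≤ 2 * (ε / |a - b|) * (∫ x, |φ x|) ^ 2 := by
  have hd : 0 < |a - b| := by linarith
  have h := abs_logPairing_sub_le (continuous_scaledBump hφ a)
    (hasCompactSupport_scaledBump hsupp hε a) (continuous_scaledBump hφ b)
    (hasCompactSupport_scaledBump hsupp hε b) (by rw [integral_scaledBump hε, hnorm])
    (by rw [integral_scaledBump hε, hnorm]) (b := 2 * (ε / |a - b|)) (c := Real.log |a - b|) ?_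
  · rwa [integral_abs_scaledBump hε, integral_abs_scaledBump hε, mul_assoc, ← sq] at h
  intro x y hx hy
  have hx' := abs_lt.mp (abs_sub_lt_of_scaledBump_ne_zero hsupp hε hx)
  have hy' := abs_lt.mp (abs_sub_lt_of_scaledBump_ne_zero hsupp hε hy)
  have he : |(x - a) - (y - b)| ≤ ε := abs_le.mpr ⟨by linarith, by linarith⟩
  have hl := abs_log_abs_add_sub_le (abs_pos.mp hd)
    (show |(x - a) - (y - b)| ≤ |a - b| / 2 by linarith)
  rw [show a - b + ((x - a) - (y - b)) = x - y by ring] at hl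
  exact hl.trans (by gcongr)

theorem deriv_smoothedInd (hφ : Continuous φ) {p q : ℝ} (hpq : p ≤ q) :
    deriv (smoothedInd φ ε (Set.Icc p q))
      = fun x => scaledBump φ ε p x - scaledBump φ ε q x := by
  have hc : Continuous fun y => ε⁻¹ * φ (y / ε) := by fun_prop
  have hfun : smoothedInd φ ε (Set.Icc p q) = fun x =>
      (∫ y in (0 : ℝ)..(x - p), ε⁻¹ * φ (y / ε)) - ∫ y in (0 : ℝ)..(x - q), ε⁻¹ * φ (y / ε) := by
    ext x
    rw [intervalIntegral.integral_interval_sub_left (hc.intervalIntegrable _ _)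
      (hc.intervalIntegrable _ _), intervalIntegral.integral_of_le (by linarith),
      ← integral_Icc_eq_integral_Ioc, ← integral_indicator measurableSet_Icc, smoothedInd]
    congr 1 with y
    have hiff : x - y ∈ Set.Icc p q ↔ y ∈ Set.Icc (x - q) (x - p) := by
      simp only [Set.mem_Icc]
      constructor <;> rintro ⟨h1, h2⟩ <;> constructor <;> linarith
    by_cases hy : y ∈ Set.Icc (x - q) (x - p)
    · rw [Set.indicator_of_mem hy, Set.indicator_of_mem (hiff.mpr hy), one_mul]
    · rw [Set.indicator_of_notMem hy, Set.indicator_of_notMem (mt hiff.mp hy), zero_mul]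
  have hder : ∀ r x : ℝ, HasDerivAt (fun x => ∫ y in (0 : ℝ)..(x - r), ε⁻¹ * φ (y / ε))
      (scaledBump φ ε r x) x := fun r x =>
    (hc.integral_hasStrictDerivAt 0 (x - r)).hasDerivAt.comp_sub_const x r
  rw [hfun]
  ext x
  exact ((hder p x).sub (hder q x)).deriv

theorem scalarProd_smoothedInd (hφ : Continuous φ)
    (hsupp : Function.support φ ⊆ Set.Ioo (-(1/2)) (1/2)) (hε : 0 < ε) {p u v : ℝ}
    (hu : p ≤ u) (hv : p ≤ v) :
    scalarProd (smoothedInd φ ε (Set.Icc p u)) (smoothedInd φ ε (Set.Icc p v))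
      = -(1 / (2 * π ^ 2)) *
        (logPairing (scaledBump φ ε p) (scaledBump φ ε p)
          - logPairing (scaledBump φ ε p) (scaledBump φ ε v)
          - logPairing (scaledBump φ ε u) (scaledBump φ ε p)
          + logPairing (scaledBump φ ε u) (scaledBump φ ε v)) := by
  have hc : ∀ a, Continuous (scaledBump φ ε a) := continuous_scaledBump hφ
  have hs : ∀ a, HasCompactSupport (scaledBump φ ε a) := hasCompactSupport_scaledBump hsupp hε
  have hpair : ∀ f g : ℝ → ℝ, ∫ x, ∫ y, f x * g y * Real.log |x - y| = logPairing f g := by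
    intro f g
    simp only [logPairing, mul_assoc, integral_const_mul]
  have hcv : Continuous fun x => scaledBump φ ε p x - scaledBump φ ε v x := (hc p).sub (hc v)
  have hsv : HasCompactSupport fun x => scaledBump φ ε p x - scaledBump φ ε v x :=
    (hs p).sub (hs v)
  rw [scalarProd, hpair, deriv_smoothedInd hφ hu, deriv_smoothedInd hφ hv,
    logPairing_sub_left (hc p) (hs p) (hc u) (hs u) hcv hsv,
    logPairing_sub_right (hc p) (hs p) (hc p) (hs p) (hc v) (hs v),
    logPairing_sub_right (hc u) (hs u) (hc p) (hs p) (hc v) (hs v)]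
  ring

/-- The pairing of a bump centred at `w ∈ (0, 1)` with the far bump at `-1/ε`, on either side. -/
theorem abs_sub_neg_log_le_of_far {ε M L w : ℝ} (hε : 0 < ε) (hw0 : 0 < w) (hw1 : w < 1)
    (hM : 0 ≤ M) (hL : |L - Real.log (1 / ε + w)| ≤ 2 * (ε / (1 / ε + w)) * M)
    (hε1 : ε < 1 / 2) : |L + Real.log ε| ≤ (2 * M + 1) * ε := by
  have hinv : 1 ≤ 1 / ε := by rw [le_div_iff₀ hε]; linarith
  have hle : 2 * (ε / (1 / ε + w)) * M ≤ 2 * ε * M := by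
    gcongr
    exact div_le_self hε.le (by linarith)
  have hlog : Real.log (1 / ε + w) = Real.log (1 + ε * w) - Real.log ε := by
    rw [← Real.log_div (by positivity) hε.ne']
    congr 1
    field_simp
  have hpos : 0 ≤ Real.log (1 + ε * w) := Real.log_nonneg (by nlinarith)
  have hup := Real.log_le_sub_one_of_pos (show 0 < 1 + ε * w by positivity)
  have hεw : ε * w ≤ ε := by nlinarith
  rw [hlog] at hL
  obtain ⟨h1, h2⟩ := abs_le.mp hL
  exact abs_le.mpr ⟨by nlinarith, by nlinarith⟩

end scaledBump

theorem stmt_2 (φ : ℝ → ℝ) (hφ : ContDiff ℝ (⊤ : ℕ∞) φ)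
    (hsupp : Function.support φ ⊆ Set.Ioo (-(1/2)) (1/2))
    (hnorm : ∫ x : ℝ, φ x = 1)
    (u v : ℝ) (hu0 : 0 < u) (hu1 : u < 1) (hv0 : 0 < v) (hv1 : v < 1) (huv : u ≠ v) :
    ∃ C > 0, ∃ ε₀ > 0, ∀ ε : ℝ, 0 < ε → ε < ε₀ →
      |scalarProd (smoothedInd φ ε (Set.Icc (-(1/ε)) u)) (smoothedInd φ ε (Set.Icc (-(1/ε)) v)) +
        (1 / (2 * π ^ 2)) *
          (3 * Real.log ε - kappa φ + Real.log |u - v|)| ≤ C * ε := by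
  have hc : Continuous φ := hφ.continuous
  have hφs : HasCompactSupport φ :=
    HasCompactSupport.of_support_subset_isCompact isCompact_Icc (hsupp.trans Ioo_subset_Icc_self)
  set M : ℝ := (∫ x, |φ x|) ^ 2 with hM
  have hM0 : 0 ≤ M := sq_nonneg _
  have hd : 0 < |u - v| := abs_pos.mpr (sub_ne_zero.mpr huv)
  refine ⟨1 / (2 * π ^ 2) * (2 / |u - v| * M + 2 * (2 * M + 1)), by positivity,
    min (1 / 2) (|u - v| / 2), by positivity, fun ε hε hlt => ?_⟩
  obtain ⟨hε1, hε2⟩ := lt_min_iff.mp hlt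
  have hinv : 2 ≤ 1 / ε := by rw [le_div_iff₀ hε]; linarith
  rw [scalarProd_smoothedInd hc hsupp hε (by linarith) (by linarith),
    logPairing_scaledBump_self hc hφs hnorm hε]
  have hnear := abs_logPairing_scaledBump_sub_log_le hc hsupp hnorm hε
    (show 2 * ε ≤ |u - v| by linarith)
  have hfar₁ := abs_logPairing_scaledBump_sub_log_le (a := -(1 / ε)) (b := v) hc hsupp hnorm hε
  have hfar₂ := abs_logPairing_scaledBump_sub_log_le (a := u) (b := -(1 / ε)) hc hsupp hnorm hε
  rw [show |-(1 / ε) - v| = 1 / ε + v by rw [abs_of_neg (by linarith)]; ring] at hfar₁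
  rw [show |u - -(1 / ε)| = 1 / ε + u by rw [abs_of_pos (by linarith)]; ring] at hfar₂
  have hv := abs_sub_neg_log_le_of_far hε hv0 hv1 hM0 (hfar₁ (by linarith)) hε1
  have hu := abs_sub_neg_log_le_of_far hε hu0 hu1 hM0 (hfar₂ (by linarith)) hε1
  set P := logPairing (scaledBump φ ε (-(1 / ε))) (scaledBump φ ε v)
  set Q := logPairing (scaledBump φ ε u) (scaledBump φ ε (-(1 / ε)))
  set R := logPairing (scaledBump φ ε u) (scaledBump φ ε v)
  rw [show -(1 / (2 * π ^ 2)) * (Real.log ε - kappa φ - P - Q + R)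
      + 1 / (2 * π ^ 2) * (3 * Real.log ε - kappa φ + Real.log |u - v|)
      = 1 / (2 * π ^ 2) * ((P + Real.log ε) + (Q + Real.log ε) - (R - Real.log |u - v|)) by ring,
    abs_mul, abs_of_pos (by positivity : 0 < 1 / (2 * π ^ 2)), mul_assoc]
  gcongr
  have hsum := abs_sub ((P + Real.log ε) + (Q + Real.log ε)) (R - Real.log |u - v|)
  have hadd := abs_add_le (P + Real.log ε) (Q + Real.log ε)
  have he : (2 / |u - v| * M + 2 * (2 * M + 1)) * ε
      = 2 * (ε / |u - v|) * M + (2 * M + 1) * ε + (2 * M + 1) * ε := by ring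
  linarith
end

section
/- Let 0 < u, v < 1. There exists a constant C > 0 (depending on φ, u, v) such that for all α ≥ 1 and all ε ∈ (0,1) with ε < min(u, v)/2: | Re ∫_{−α}^{α} |w| · f̂⁽¹⁾_{ε,u}(w) · conj( f̂⁽¹⁾_{ε,v}(w) ) dw − ⟨f⁽¹⁾_{ε,u}, f⁽¹⁾_{ε,v}⟩ | ≤ C/(α·ε), where conj denotes complex conjugation. -/
open MeasureTheory Real Set

/-- The Fourier transform f̂(w) = (1/2π) ∫ f(x) e^{−iwx} dx. -/
noncomputable def fourierT (f : ℝ → ℝ) (w : ℝ) : ℂ :=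
  (1 / (2 * (π : ℂ))) * ∫ x : ℝ, (f x : ℂ) * Complex.exp (-(Complex.I * w * x))

open Filter Topology

/-- The entire cosine integral `∫₀ᵗ (cos s - 1) / s ds`. -/
noncomputable def entireCosIntegral (t : ℝ) : ℝ :=
  ∫ s in (0 : ℝ)..t, dslope cos 0 s

lemma continuous_dslope_cos : Continuous (dslope cos 0) := by
  rw [← continuousOn_univ, continuousOn_dslope univ_mem]
  exact ⟨continuous_cos.continuousOn, differentiable_cos.differentiableAt⟩

lemma dslope_cos_eq (s : ℝ) : dslope cos 0 s = (cos s - 1) / s := by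
  rcases eq_or_ne s 0 with rfl | hs
  · simp
  · rw [dslope_of_ne _ hs, slope_def_field]
    simp

lemma abs_cos_sub_one_le (t : ℝ) : |cos t - 1| ≤ |t| := by
  simpa using abs_cos_sub_cos_le t 0

lemma hasDerivAt_entireCosIntegral (t : ℝ) :
    HasDerivAt entireCosIntegral (dslope cos 0 t) t :=
  (continuous_dslope_cos.integral_hasStrictDerivAt 0 t).hasDerivAt

lemma continuous_entireCosIntegral : Continuous entireCosIntegral :=
  continuous_iff_continuousAt.2 fun t => (hasDerivAt_entireCosIntegral t).continuousAt

lemma entireCosIntegral_neg (t : ℝ) : entireCosIntegral (-t) = entireCosIntegral t := by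
  have h := intervalIntegral.integral_comp_neg (a := 0) (b := t) (dslope cos 0)
  have h2 : ∀ s, dslope cos 0 (-s) = -dslope cos 0 s := fun s => by
    simp [dslope_cos_eq, div_neg]
  simp only [h2, intervalIntegral.integral_neg, neg_zero] at h
  rw [entireCosIntegral, intervalIntegral.integral_symm, ← h, neg_neg, entireCosIntegral]

lemma integral_cos_sub_one_div (a z : ℝ) :
    ∫ w in (0 : ℝ)..a, (cos (w * z) - 1) / w = entireCosIntegral (a * z) := by
  rw [entireCosIntegral, ← zero_mul z, ← intervalIntegral.mul_integral_comp_mul_right,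
    ← intervalIntegral.integral_const_mul]
  rw [zero_mul]
  refine intervalIntegral.integral_congr fun w _ => ?_
  simp only [dslope_cos_eq]
  rcases eq_or_ne z 0 with rfl | hz
  · simp
  · rcases eq_or_ne w 0 with rfl | hw
    · simp
    · field_simp

lemma setIntegral_cos_sub_one_div_abs {a : ℝ} (ha : 0 ≤ a) (z : ℝ) :
    ∫ w in Icc (-a) a, (cos (w * z) - 1) / |w| = 2 * entireCosIntegral (a * z) := by
  have hint : IntegrableOn (fun w : ℝ => (cos (w * z) - 1) / |w|) (Icc (-a) a) := by
    refine Measure.integrableOn_of_bounded (M := |z|) (by simp) ?_ ?_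
    · exact (by fun_prop : Measurable fun w : ℝ => (cos (w * z) - 1) / |w|).aestronglyMeasurable
    · refine ae_of_all _ fun w => ?_
      rcases eq_or_ne w 0 with rfl | hw
      · simp
      · rw [norm_eq_abs, abs_div, abs_abs, div_le_iff₀ (abs_pos.2 hw), mul_comm |z|, ← abs_mul]
        exact abs_cos_sub_one_le _
  have hi : ∀ b c, b ∈ Icc (-a) a → c ∈ Icc (-a) a →
      IntervalIntegrable (fun w : ℝ => (cos (w * z) - 1) / |w|) volume b c := fun b c hb hc =>
    (hint.mono_set (uIcc_subset_Icc hb hc)).intervalIntegrable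
  have h0 : (0 : ℝ) ∈ Icc (-a) a := ⟨by linarith, ha⟩
  rw [integral_Icc_eq_integral_Ioc, ← intervalIntegral.integral_of_le (by linarith),
    ← intervalIntegral.integral_add_adjacent_intervals (hi (-a) 0 ⟨le_rfl, by linarith⟩ h0)
      (hi 0 a h0 ⟨by linarith, le_rfl⟩)]
  have h2 : ∫ w in (0 : ℝ)..a, (cos (w * z) - 1) / |w| = entireCosIntegral (a * z) := by
    rw [← integral_cos_sub_one_div]
    refine intervalIntegral.integral_congr fun w hw => ?_
    rw [uIcc_of_le ha] at hw
    simp only [abs_of_nonneg hw.1]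
  have h1 : ∫ w in (-a)..0, (cos (w * z) - 1) / |w| = entireCosIntegral (a * z) := by
    rw [← h2]
    simpa using (intervalIntegral.integral_comp_neg (a := 0) (b := a)
      (fun w => (cos (w * z) - 1) / |w|)).symm
  rw [h1, h2, two_mul]

lemma exists_tendsto_entireCosIntegral_add_log :
    ∃ c, Tendsto (fun t => entireCosIntegral t + log t) atTop (𝓝 c) := by
  have hd : ∀ t ∈ Ioi (1 : ℝ), HasDerivAt (fun t => entireCosIntegral t + log t - sin t / t)
      (sin t / t ^ 2) t := by
    intro t ht
    have ht0 : t ≠ 0 := (zero_lt_one.trans ht).ne'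
    refine (((hasDerivAt_entireCosIntegral t).add (hasDerivAt_log ht0)).sub
      ((hasDerivAt_sin t).div (hasDerivAt_id t) ht0)).congr_deriv ?_
    rw [dslope_cos_eq]
    simp only [id]
    field_simp
    ring
  have hint : IntegrableOn (fun t : ℝ => sin t / t ^ 2) (Ioi 1) := by
    refine (integrableOn_Ioi_rpow_of_lt (by norm_num : (-2 : ℝ) < -1) zero_lt_one).mono'
      (by fun_prop : Measurable fun t : ℝ => sin t / t ^ 2).aestronglyMeasurable ?_
    refine (ae_restrict_iff' measurableSet_Ioi).2 (ae_of_all _ fun t ht => ?_)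
    have ht0 : (0 : ℝ) < t := zero_lt_one.trans ht
    rw [rpow_neg ht0.le, norm_eq_abs, abs_div, abs_of_nonneg (sq_nonneg t), div_eq_mul_inv]
    norm_cast
    exact mul_le_of_le_one_left (by positivity) (abs_sin_le_one t)
  have h1 := tendsto_limUnder_of_hasDerivAt_of_integrableOn_Ioi hd hint
  have h2 : Tendsto (fun t : ℝ => sin t / t) atTop (𝓝 0) := by
    refine squeeze_zero_norm' (a := fun t => t⁻¹) ?_ tendsto_inv_atTop_zero
    filter_upwards [eventually_gt_atTop 0] with t ht
    rw [norm_eq_abs, abs_div, abs_of_pos ht, div_eq_mul_inv]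
    exact mul_le_of_le_one_left (by positivity) (abs_sin_le_one t)
  exact ⟨_, by simpa using h1.add h2⟩

lemma exists_entireCosIntegral_add_log_bound :
    ∃ c M : ℝ, Tendsto (fun t => entireCosIntegral t + log t) atTop (𝓝 c) ∧
      ∀ b z : ℝ, 1 ≤ b → z ≠ 0 → |entireCosIntegral (b * z) + log (b * z) - c| ≤ M + |log z| := by
  obtain ⟨c, hc⟩ := exists_tendsto_entireCosIntegral_add_log
  obtain ⟨T, hT⟩ := eventually_atTop.1 ((tendsto_order.1 (hc.sub_const c).abs).2 1 (by simp))
  obtain ⟨M₁, hM₁⟩ := isCompact_Icc.exists_bound_of_continuousOn (s := Icc 0 (max 1 T))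
    continuous_entireCosIntegral.continuousOn
  refine ⟨c, M₁ + |c| + |log (max 1 T)| + 1, hc, fun b z hb hz => ?_⟩
  have hM₀ : 0 ≤ M₁ := (norm_nonneg _).trans (hM₁ 0 ⟨le_rfl, by positivity⟩)
  have hb0 : 0 < b := by linarith
  have key : ∀ z : ℝ, 0 < z →
      |entireCosIntegral (b * z) + log (b * z) - c| ≤ M₁ + |c| + |log (max 1 T)| + 1 + |log z| := by
    intro z hz
    have hbz : 0 < b * z := mul_pos hb0 hz
    rcases le_or_gt T (b * z) with h | h
    · have := hT _ h
      have := abs_nonneg c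
      have := abs_nonneg (log z)
      have := abs_nonneg (log (max 1 T))
      linarith
    · have h1 := hM₁ (b * z) ⟨hbz.le, h.le.trans (le_max_right _ _)⟩
      rw [norm_eq_abs] at h1
      have h2 : |log (b * z)| ≤ |log (max 1 T)| + |log z| := by
        rw [abs_le]
        constructor
        · have h3 : log z ≤ log (b * z) := log_le_log hz (le_mul_of_one_le_left hz.le hb)
          have := neg_abs_le (log z)
          have := abs_nonneg (log (max 1 T))
          linarith
        · have h3 : log (b * z) ≤ log (max 1 T) := log_le_log hbz (h.le.trans (le_max_right _ _))
          have := le_abs_self (log (max 1 T))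
          have := abs_nonneg (log z)
          linarith
      have h3 := abs_sub (entireCosIntegral (b * z) + log (b * z)) c
      have h4 := abs_add_le (entireCosIntegral (b * z)) (log (b * z))
      linarith
  rcases hz.lt_or_gt with h | h
  · have := key (-z) (by linarith)
    rwa [mul_neg, entireCosIntegral_neg, log_neg_eq_log, log_neg_eq_log] at this
  · exact key z h

/-- The cross-correlation `z ↦ ∫ h(x) k(x - z) dx`. -/
noncomputable def crossCorr (h k : ℝ → ℝ) (z : ℝ) : ℝ :=
  ∫ x : ℝ, h x * k (x - z)

lemma crossCorr_eq_convolution (h k : ℝ → ℝ) :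
    crossCorr h k = convolution h (fun t => k (-t)) (ContinuousLinearMap.mul ℝ ℝ) volume := by
  ext z
  simp [crossCorr, convolution_def]

lemma continuous_crossCorr {h k : ℝ → ℝ} (hh : Continuous h) (hk : Continuous k)
    (hhs : HasCompactSupport h) : Continuous (crossCorr h k) := by
  rw [crossCorr_eq_convolution]
  exact hhs.continuous_convolution_left _ hh
    (hk.comp continuous_neg).locallyIntegrable

lemma hasCompactSupport_crossCorr {h k : ℝ → ℝ} (hhs : HasCompactSupport h)
    (hks : HasCompactSupport k) : HasCompactSupport (crossCorr h k) := by
  rw [crossCorr_eq_convolution]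
  exact hhs.convolution _ (hks.comp_homeomorph (Homeomorph.neg ℝ))

lemma exists_forall_eq_zero_of_hasCompactSupport {h : ℝ → ℝ} (hhs : HasCompactSupport h) :
    ∃ R, ∀ x, R < |x| → h x = 0 := by
  obtain ⟨R, hR⟩ := hhs.isCompact.isBounded.subset_closedBall 0
  refine ⟨R, fun x hx => image_eq_zero_of_notMem_tsupport fun hx' => ?_⟩
  have := hR hx'
  simp only [mem_closedBall_zero_iff, norm_eq_abs] at this
  linarith

lemma integral_integral_mul_comp_sub {h k ψ : ℝ → ℝ} (hh : Continuous h) (hk : Continuous k)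
    (hhs : HasCompactSupport h) (hks : HasCompactSupport k) (hψ : LocallyIntegrable ψ) :
    ∫ x : ℝ, ∫ y : ℝ, h x * k y * ψ (x - y) = ∫ z : ℝ, crossCorr h k z * ψ z := by
  obtain ⟨R₁, hR₁⟩ := exists_forall_eq_zero_of_hasCompactSupport hhs
  obtain ⟨R₂, hR₂⟩ := exists_forall_eq_zero_of_hasCompactSupport hks
  obtain ⟨M, hM⟩ := hks.exists_bound_of_continuous hk
  set K : Set ℝ := Icc (-(R₁ + R₂)) (R₁ + R₂) with hK
  have hψK : Integrable (K.indicator ψ) :=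
    (hψ.integrableOn_isCompact isCompact_Icc).integrable_indicator measurableSet_Icc
  have hint : Integrable (Function.uncurry fun x z : ℝ => h x * k (x - z) * ψ z)
      (volume.prod volume) := by
    have h1 : Integrable (fun p : ℝ × ℝ => k (p.1 - p.2) * (h p.1 * K.indicator ψ p.2))
        (volume.prod volume) :=
      ((hh.integrable_of_hasCompactSupport hhs).mul_prod hψK).bdd_mul
        (by fun_prop) (ae_of_all _ fun p => hM _)
    refine h1.congr (ae_of_all _ fun p => ?_)
    simp only [Function.uncurry]
    by_cases hp : p.2 ∈ K
    · rw [indicator_of_mem hp]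
      ring
    · have : h p.1 = 0 ∨ k (p.1 - p.2) = 0 := by
        by_contra! hne
        have h1 := not_lt.1 (mt (hR₁ p.1) hne.1)
        have h2 := not_lt.1 (mt (hR₂ (p.1 - p.2)) hne.2)
        rw [abs_le] at h1 h2
        exact hp ⟨by linarith, by linarith⟩
      rcases this with h0 | h0 <;> simp [h0]
  calc ∫ x : ℝ, ∫ y : ℝ, h x * k y * ψ (x - y)
      = ∫ x : ℝ, ∫ z : ℝ, h x * k (x - z) * ψ z := by
        congr 1 with x
        rw [← integral_sub_left_eq_self _ volume x]
        simp
    _ = ∫ z : ℝ, ∫ x : ℝ, h x * k (x - z) * ψ z := integral_integral_swap hint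
    _ = _ := by
        congr 1 with z
        rw [crossCorr, integral_mul_const]

lemma integral_crossCorr {h k : ℝ → ℝ} (hh : Continuous h) (hk : Continuous k)
    (hhs : HasCompactSupport h) (hks : HasCompactSupport k) :
    ∫ z : ℝ, crossCorr h k z = (∫ x : ℝ, h x) * ∫ y : ℝ, k y := by
  have := integral_integral_mul_comp_sub hh hk hhs hks (ψ := fun _ => 1)
    continuous_const.locallyIntegrable
  simp only [mul_one] at this
  rw [← this, ← integral_mul_const]
  congr 1 with x
  rw [integral_const_mul]

lemma integrable_mul_cexp {h : ℝ → ℝ} (hh : Integrable h) (w : ℝ) :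
    Integrable fun x : ℝ => (h x : ℂ) * Complex.exp (-(Complex.I * w * x)) := by
  refine hh.ofReal.mul_bdd (c := 1) (by fun_prop) (ae_of_all _ fun x => ?_)
  rw [Complex.norm_exp]
  simp

lemma continuous_fourierT {h : ℝ → ℝ} (hh : Integrable h) : Continuous (fourierT h) := by
  refine continuous_const.mul (continuous_of_dominated (bound := fun x => ‖h x‖)
    (fun w => (integrable_mul_cexp hh w).aestronglyMeasurable)
    (fun w => ae_of_all _ fun x => ?_) hh.norm (ae_of_all _ fun x => by fun_prop))
  rw [norm_mul, Complex.norm_exp]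
  simp

lemma norm_fourierT_le (h : ℝ → ℝ) (w : ℝ) :
    ‖fourierT h w‖ ≤ 1 / (2 * π) * ∫ x, |h x| := by
  rw [fourierT, norm_mul]
  refine mul_le_mul (by simp [abs_of_pos pi_pos]) ?_ (norm_nonneg _) (by positivity)
  refine (norm_integral_le_integral_norm _).trans_eq ?_
  congr 1 with x
  rw [norm_mul, Complex.norm_exp]
  simp

lemma fourierT_deriv {f : ℝ → ℝ} (hf : ContDiff ℝ 1 f) (hfs : HasCompactSupport f) (w : ℝ) :
    fourierT (deriv f) w = Complex.I * w * fourierT f w := by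
  have hd : ∀ x, HasDerivAt (fun x : ℝ => (f x : ℂ)) ((deriv f x : ℝ) : ℂ) x := fun x =>
    (hf.differentiable one_ne_zero x).hasDerivAt.ofReal_comp
  have he : ∀ x : ℝ, HasDerivAt (fun x : ℝ => Complex.exp (-(Complex.I * w * x)))
      (Complex.exp (-(Complex.I * w * x)) * (-(Complex.I * w))) x := fun x => by
    have := ((Complex.ofRealCLM.hasDerivAt (x := x)).const_mul (Complex.I * w)).neg.cexp
    simpa using this
  have hfi := hf.continuous.integrable_of_hasCompactSupport (μ := volume) hfs
  have hfi' := (hf.continuous_deriv le_rfl).integrable_of_hasCompactSupport (μ := volume) hfs.deriv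
  have h1 := integral_mul_deriv_eq_deriv_mul_of_integrable (fun x _ => hd x) (fun x _ => he x)
    (by simpa [Pi.mul_def, mul_assoc] using
      ((integrable_mul_cexp hfi w).mul_const (-(Complex.I * w))))
    (integrable_mul_cexp hfi' w) (integrable_mul_cexp hfi w)
  simp only [← mul_assoc, integral_mul_const] at h1
  rw [fourierT, fourierT]
  linear_combination (1 / (2 * (π : ℂ))) * h1

lemma re_fourierT_mul_conj {h k : ℝ → ℝ} (hh : Continuous h) (hk : Continuous k)
    (hhs : HasCompactSupport h) (hks : HasCompactSupport k) (w : ℝ) :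
    (fourierT h w * (starRingEnd ℂ) (fourierT k w)).re =
      1 / (4 * π ^ 2) * ∫ z : ℝ, crossCorr h k z * cos (w * z) := by
  have hre : ∀ {h : ℝ → ℝ}, Integrable h →
      (fourierT h w).re = 1 / (2 * π) * ∫ x, h x * cos (w * x) := by
    intro h hi
    have h1 := Complex.reCLM.integral_comp_comm (integrable_mul_cexp hi w)
    rw [fourierT, show (1 / (2 * (π : ℂ))) = ((1 / (2 * π) : ℝ) : ℂ) by push_cast; rfl,
      Complex.re_ofReal_mul]
    congr 1
    refine h1.symm.trans ?_
    congr 1 with x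
    simp [Complex.exp_re]
  have him : ∀ {h : ℝ → ℝ}, Integrable h →
      (fourierT h w).im = -(1 / (2 * π) * ∫ x, h x * sin (w * x)) := by
    intro h hi
    have h1 := Complex.imCLM.integral_comp_comm (integrable_mul_cexp hi w)
    rw [fourierT, show (1 / (2 * (π : ℂ))) = ((1 / (2 * π) : ℝ) : ℂ) by push_cast; rfl,
      Complex.im_ofReal_mul, ← mul_neg, ← integral_neg]
    congr 1
    refine h1.symm.trans ?_
    congr 1 with x
    simp [Complex.exp_im]
  have hhi := hh.integrable_of_hasCompactSupport (μ := volume) hhs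
  have hki := hk.integrable_of_hasCompactSupport (μ := volume) hks
  have hhc : Integrable fun x => h x * cos (w * x) :=
    (hh.mul (by fun_prop)).integrable_of_hasCompactSupport hhs.mul_right
  have hhsn : Integrable fun x => h x * sin (w * x) :=
    (hh.mul (by fun_prop)).integrable_of_hasCompactSupport hhs.mul_right
  have hkc : Integrable fun x => k x * cos (w * x) :=
    (hk.mul (by fun_prop)).integrable_of_hasCompactSupport hks.mul_right
  have hksn : Integrable fun x => k x * sin (w * x) :=
    (hk.mul (by fun_prop)).integrable_of_hasCompactSupport hks.mul_right
  rw [← integral_integral_mul_comp_sub hh hk hhs hks (ψ := fun z => cos (w * z))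
    (by fun_prop : Continuous fun z => cos (w * z)).locallyIntegrable, Complex.mul_re,
    Complex.conj_re, Complex.conj_im, hre hhi, hre hki, him hhi, him hki]
  have key : ∫ x : ℝ, ∫ y : ℝ, h x * k y * cos (w * (x - y)) =
      (∫ x, h x * cos (w * x)) * (∫ x, k x * cos (w * x)) +
        (∫ x, h x * sin (w * x)) * (∫ x, k x * sin (w * x)) := by
    rw [← integral_mul_const, ← integral_mul_const, ← integral_add (hhc.mul_const _)
      (hhsn.mul_const _)]
    congr 1 with x
    rw [← integral_const_mul, ← integral_const_mul, ← integral_add (hkc.const_mul _)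
      (hksn.const_mul _)]
    congr 1 with y
    rw [mul_sub, cos_sub]
    ring
  rw [key]
  field_simp
  ring

lemma setIntegral_fourierT_eq_entireCosIntegral {h k : ℝ → ℝ} (hh : Continuous h)
    (hk : Continuous k) (hhs : HasCompactSupport h) (hks : HasCompactSupport k)
    (h0 : ∫ x, h x = 0) {a : ℝ} (ha : 0 ≤ a) :
    ∫ w in Icc (-a) a, (fourierT h w * (starRingEnd ℂ) (fourierT k w)).re / |w| =
      1 / (2 * π ^ 2) * ∫ z : ℝ, crossCorr h k z * entireCosIntegral (a * z) := by
  have hr := continuous_crossCorr hh hk hhs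
  have hrs := hasCompactSupport_crossCorr hhs hks
  have hr0 : ∫ z, crossCorr h k z = 0 := by rw [integral_crossCorr hh hk hhs hks, h0, zero_mul]
  have hint : Integrable (Function.uncurry fun w z : ℝ =>
      crossCorr h k z * ((cos (w * z) - 1) / |w|)) ((volume.restrict (Icc (-a) a)).prod volume) := by
    have h1 : Integrable (fun p : ℝ × ℝ => (1 : ℝ) * (crossCorr h k p.2 * p.2))
        ((volume.restrict (Icc (-a) a)).prod volume) :=
      (integrable_const (1 : ℝ)).mul_prod
        ((hr.mul continuous_id).integrable_of_hasCompactSupport hrs.mul_right)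
    refine h1.mono ?_ (ae_of_all _ fun p => ?_)
    · have := hr.measurable
      exact (by fun_prop : Measurable fun p : ℝ × ℝ =>
        crossCorr h k p.2 * ((cos (p.1 * p.2) - 1) / |p.1|)).aestronglyMeasurable
    · simp only [Function.uncurry, one_mul, norm_mul]
      refine mul_le_mul_of_nonneg_left ?_ (norm_nonneg _)
      rcases eq_or_ne p.1 0 with hw | hw
      · simp [hw]
      · rw [norm_div, norm_eq_abs, norm_eq_abs, abs_abs, div_le_iff₀ (abs_pos.2 hw), mul_comm,
          norm_eq_abs, ← abs_mul]
        exact abs_cos_sub_one_le _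
  have hre : ∀ w, (fourierT h w * (starRingEnd ℂ) (fourierT k w)).re / |w| =
      1 / (4 * π ^ 2) * ∫ z, crossCorr h k z * ((cos (w * z) - 1) / |w|) := fun w => by
    have hi : Integrable fun z => crossCorr h k z * cos (w * z) :=
      (hr.mul (by fun_prop)).integrable_of_hasCompactSupport hrs.mul_right
    have hi' := hr.integrable_of_hasCompactSupport (μ := volume) hrs
    rw [re_fourierT_mul_conj hh hk hhs hks, mul_div_assoc, ← integral_div]
    rw [← sub_zero (∫ z, crossCorr h k z * cos (w * z) / |w|), ← zero_div |w|, ← hr0,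
      ← integral_div, ← integral_sub (hi.div_const _) (hi'.div_const _)]
    congr 2 with z
    ring
  simp_rw [hre]
  rw [integral_const_mul, integral_integral_swap hint]
  simp_rw [integral_const_mul, setIntegral_cos_sub_one_div_abs ha, mul_left_comm _ (2 : ℝ)]
  rw [integral_const_mul]
  ring

lemma locallyIntegrable_log_s10 : LocallyIntegrable log := by
  rw [locallyIntegrable_iff]
  intro K hK
  obtain ⟨R, hR⟩ := hK.isBounded.subset_closedBall 0
  rw [Real.closedBall_eq_Icc] at hR
  refine IntegrableOn.mono_set ?_ hR
  rcases le_or_gt (0 - R) (0 + R) with h | h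
  · exact (intervalIntegrable_iff_integrableOn_Icc_of_le h).1 intervalIntegral.intervalIntegrable_log'
  · rw [Icc_eq_empty (not_le.2 h)]
    exact integrableOn_empty

lemma tendsto_setIntegral_fourierT {h k : ℝ → ℝ} (hh : Continuous h)
    (hk : Continuous k) (hhs : HasCompactSupport h) (hks : HasCompactSupport k)
    (h0 : ∫ x, h x = 0) :
    Tendsto (fun a => ∫ w in Icc (-a) a, (fourierT h w * (starRingEnd ℂ) (fourierT k w)).re / |w|)
      atTop (𝓝 (-(1 / (2 * π ^ 2)) * ∫ x, ∫ y, h x * k y * log |x - y|)) := by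
  obtain ⟨c, M, hc, hM⟩ := exists_entireCosIntegral_add_log_bound
  have hr := continuous_crossCorr hh hk hhs
  have hrs := hasCompactSupport_crossCorr hhs hks
  have hri := hr.integrable_of_hasCompactSupport (μ := volume) hrs
  have hr0 : ∫ z, crossCorr h k z = 0 := by rw [integral_crossCorr hh hk hhs hks, h0, zero_mul]
  have hrl : Integrable fun z => crossCorr h k z * log z :=
    locallyIntegrable_log_s10.integrable_smul_left_of_hasCompactSupport hr hrs
  have hne : ∀ᵐ z : ℝ, z ≠ 0 := by simp [ae_iff]
  have hlim : Tendsto (fun a => ∫ z, crossCorr h k z *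
      (entireCosIntegral (a * z) + log (a * z) - c)) atTop (𝓝 (∫ _z : ℝ, (0 : ℝ))) := by
    refine tendsto_integral_filter_of_dominated_convergence
      (fun z => |crossCorr h k z * M| + |crossCorr h k z * log z|) ?_ ?_
      ((hri.mul_const M).abs.add hrl.abs) ?_
    · refine Eventually.of_forall fun a => ?_
      have h1 := hr.measurable
      have h2 := continuous_entireCosIntegral.measurable
      exact (by fun_prop : Measurable fun z => crossCorr h k z *
        (entireCosIntegral (a * z) + log (a * z) - c)).aestronglyMeasurable
    · filter_upwards [eventually_ge_atTop 1] with a ha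
      filter_upwards [hne] with z hz
      rw [norm_eq_abs, abs_mul, abs_mul, abs_mul, ← mul_add]
      refine mul_le_mul_of_nonneg_left ((hM a z ha hz).trans ?_) (abs_nonneg _)
      have := le_abs_self M
      linarith
    · filter_upwards [hne] with z hz
      have habs : ∀ a : ℝ,
          entireCosIntegral (a * |z|) + log (a * |z|) = entireCosIntegral (a * z) + log (a * z) := by
        intro a
        rcases abs_choice z with h | h <;> rw [h]
        rw [mul_neg, entireCosIntegral_neg, log_neg_eq_log]
      have h1 : Tendsto (fun a => entireCosIntegral (a * |z|) + log (a * |z|)) atTop (𝓝 c) :=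
        hc.comp (tendsto_id.atTop_mul_const (abs_pos.2 hz))
      simpa using ((h1.congr habs).sub_const c).const_mul (crossCorr h k z)
  have heq : ∫ x, ∫ y, h x * k y * log |x - y| = ∫ z, crossCorr h k z * log z := by
    simp_rw [log_abs]
    exact integral_integral_mul_comp_sub hh hk hhs hks locallyIntegrable_log_s10
  rw [heq]
  have hlim' := (hlim.const_mul (1 / (2 * π ^ 2))).sub_const
    (1 / (2 * π ^ 2) * ∫ z, crossCorr h k z * log z)
  simp only [integral_zero, mul_zero, zero_sub, ← neg_mul] at hlim'
  refine hlim'.congr' ?_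
  filter_upwards [eventually_gt_atTop 0] with a ha
  have hce : Integrable fun z => crossCorr h k z * entireCosIntegral (a * z) :=
    (hr.mul (continuous_entireCosIntegral.comp (by fun_prop))).integrable_of_hasCompactSupport
      hrs.mul_right
  have hsplit : ∫ z, crossCorr h k z * (entireCosIntegral (a * z) + log (a * z) - c) =
      (∫ z, crossCorr h k z * entireCosIntegral (a * z)) + (∫ z, crossCorr h k z * log z) := by
    have h1 : ∫ z, crossCorr h k z * (log a - c) = 0 := by rw [integral_mul_const, hr0, zero_mul]
    have h2 : Integrable fun z => crossCorr h k z * entireCosIntegral (a * z) +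
        crossCorr h k z * log z := hce.add hrl
    rw [← integral_add hce hrl, ← add_zero (∫ z, _ + _), ← h1,
      ← integral_add h2 (hri.mul_const _)]
    refine integral_congr_ae ?_
    filter_upwards [hne] with z hz
    rw [log_mul ha.ne' hz]
    ring
  rw [setIntegral_fourierT_eq_entireCosIntegral hh hk hhs hks h0 ha.le, hsplit]
  ring

lemma abs_setIntegral_Icc_sub_le {G : ℝ → ℝ} (hG : Continuous G) {D : ℝ}
    (hD : ∀ w, w ≠ 0 → |G w| ≤ D / w ^ 2) {a b : ℝ} (ha : 0 < a) (hab : a ≤ b) :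
    |(∫ w in Icc (-b) b, G w) - ∫ w in Icc (-a) a, G w| ≤ 2 * D / a := by
  have hD0 : 0 ≤ D := by simpa using (abs_nonneg _).trans (hD 1 one_ne_zero)
  have hb : 0 < b := ha.trans_le hab
  have hi : ∀ x y, IntervalIntegrable G volume x y := fun x y => hG.intervalIntegrable x y
  have hinv : ∫ w in a..b, D / w ^ 2 = D * (1 / a - 1 / b) := by
    have hd : ∀ w ∈ uIcc a b, HasDerivAt (fun w : ℝ => -(D / w)) (D / w ^ 2) w := fun w hw => by
      rw [uIcc_of_le hab] at hw
      have hw0 : w ≠ 0 := (ha.trans_le hw.1).ne'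
      refine (((hasDerivAt_inv hw0).const_mul D).neg).congr_deriv ?_
      field_simp
    rw [intervalIntegral.integral_eq_sub_of_hasDerivAt hd]
    · ring
    · refine ContinuousOn.intervalIntegrable fun w hw => ?_
      rw [uIcc_of_le hab] at hw
      have hw0 : w ^ 2 ≠ 0 := pow_ne_zero 2 (ha.trans_le hw.1).ne'
      exact ContinuousAt.continuousWithinAt (by fun_prop (disch := exact hw0))
  have hle : D * (1 / a - 1 / b) ≤ D / a := by
    rw [mul_sub, mul_one_div, mul_one_div]
    have : 0 ≤ D / b := by positivity
    linarith
  have hhalf : ∀ G : ℝ → ℝ, (∀ w, w ≠ 0 → |G w| ≤ D / w ^ 2) → |∫ w in a..b, G w| ≤ D / a := by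
    intro G hG
    refine (intervalIntegral.norm_integral_le_of_norm_le (f := G) (g := fun w => D / w ^ 2) hab
      (ae_of_all _ fun w hw => hG w (ha.trans hw.1).ne') ?_).trans (hinv.trans_le hle)
    refine ContinuousOn.intervalIntegrable fun w hw => ?_
    rw [uIcc_of_le hab] at hw
    have hw0 : w ^ 2 ≠ 0 := pow_ne_zero 2 (ha.trans_le hw.1).ne'
    exact ContinuousAt.continuousWithinAt (by fun_prop (disch := exact hw0))
  have hneg : ∫ w in (-b)..(-a), G w = ∫ w in a..b, G (-w) :=
    (intervalIntegral.integral_comp_neg _).symm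
  rw [integral_Icc_eq_integral_Ioc, integral_Icc_eq_integral_Ioc,
    ← intervalIntegral.integral_of_le (by linarith), ← intervalIntegral.integral_of_le (by linarith),
    ← intervalIntegral.integral_add_adjacent_intervals (hi (-b) (-a)) (hi (-a) b),
    ← intervalIntegral.integral_add_adjacent_intervals (hi (-a) a) (hi a b), hneg,
    show ∀ x y z : ℝ, x + (y + z) - y = x + z by intros; ring]
  refine (abs_add_le _ _).trans ?_
  rw [mul_div_assoc, two_mul]
  refine add_le_add (hhalf _ fun w hw => ?_) (hhalf _ hD)
  simpa using hD (-w) (neg_ne_zero.2 hw)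

/-- For `C²` compactly supported functions, the frequency-space form of `scalarProd` truncated at
height `α` converges to `scalarProd` at rate `1 / α`. -/
lemma abs_re_setIntegral_fourierT_sub_scalarProd_le {f g : ℝ → ℝ} (hf : ContDiff ℝ 2 f)
    (hg : ContDiff ℝ 2 g) (hfs : HasCompactSupport f) (hgs : HasCompactSupport g) {α : ℝ}
    (hα : 0 < α) :
    |(∫ w in Icc (-α) α, ((|w| : ℝ) : ℂ) * fourierT f w * (starRingEnd ℂ) (fourierT g w)).re -
        scalarProd f g| ≤ (∫ x, |deriv f x|) * (∫ x, |deriv (deriv g) x|) / α := by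
  have hf1 : ContDiff ℝ 1 f := hf.of_le (by norm_num)
  have hg1 : ContDiff ℝ 1 g := hg.of_le (by norm_num)
  have hf' : Continuous (deriv f) := hf1.continuous_deriv le_rfl
  have hg' : ContDiff ℝ 1 (deriv g) := ((contDiff_succ_iff_deriv (n := 1)).1 hg).2.2
  have hfi := hf.continuous.integrable_of_hasCompactSupport (μ := volume) hfs
  have hgi := hg.continuous.integrable_of_hasCompactSupport (μ := volume) hgs
  have hfi' := hf'.integrable_of_hasCompactSupport (μ := volume) hfs.deriv
  have h0 : ∫ x, deriv f x = 0 := integral_eq_zero_of_hasDerivAt_of_integrable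
    (fun x => (hf1.differentiable one_ne_zero x).hasDerivAt) hfi' hfi
  set F : ℝ → ℂ := fun w => ((|w| : ℝ) : ℂ) * fourierT f w * (starRingEnd ℂ) (fourierT g w) with hF
  have hFc : Continuous F := by
    have h1 := continuous_fourierT hfi
    have h2 := Complex.continuous_conj.comp (continuous_fourierT hgi)
    exact (by fun_prop : Continuous fun w : ℝ => ((|w| : ℝ) : ℂ) * fourierT f w).mul h2
  have hFre : ∀ w, (F w).re =
      (fourierT (deriv f) w * (starRingEnd ℂ) (fourierT (deriv g) w)).re / |w| := by
    intro w
    rcases eq_or_ne w 0 with rfl | hw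
    · simp [hF]
    have h1 : fourierT (deriv f) w * (starRingEnd ℂ) (fourierT (deriv g) w) =
        ((w ^ 2 : ℝ) : ℂ) * (fourierT f w * (starRingEnd ℂ) (fourierT g w)) := by
      rw [fourierT_deriv hf1 hfs, fourierT_deriv hg1 hgs, map_mul, map_mul, Complex.conj_I,
        Complex.conj_ofReal]
      push_cast
      linear_combination (-(w : ℂ) ^ 2 * fourierT f w * (starRingEnd ℂ) (fourierT g w)) *
        Complex.I_mul_I
    have hw' : |w| ≠ 0 := abs_ne_zero.2 hw
    have hFw : F w = ((|w| : ℝ) : ℂ) * (fourierT f w * (starRingEnd ℂ) (fourierT g w)) :=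
      mul_assoc _ _ _
    rw [h1, hFw, Complex.re_ofReal_mul, Complex.re_ofReal_mul, ← sq_abs]
    field_simp
  have hre : ∀ a : ℝ, ∫ w in Icc (-a) a, (F w).re = (∫ w in Icc (-a) a, F w).re := fun a =>
    Complex.reCLM.integral_comp_comm hFc.continuousOn.integrableOn_Icc
  set A := ∫ x, |deriv f x|
  set B := ∫ x, |deriv (deriv g) x|
  have hA : 0 ≤ A := integral_nonneg fun x => abs_nonneg _
  have hB : 0 ≤ B := integral_nonneg fun x => abs_nonneg _
  have hbound : ∀ w, w ≠ 0 → |(F w).re| ≤ (A * B / 2) / w ^ 2 := by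
    intro w hw
    have hw' : 0 < |w| := abs_pos.2 hw
    have h2 : |w| * ‖fourierT (deriv g) w‖ ≤ 1 / (2 * π) * B := by
      have := norm_fourierT_le (deriv (deriv g)) w
      rwa [fourierT_deriv hg' hgs.deriv, norm_mul, norm_mul, Complex.norm_I, one_mul,
        Complex.norm_real, norm_eq_abs] at this
    have h3 := norm_fourierT_le (deriv f) w
    have hπ : 1 / (2 * π) * (1 / (2 * π)) ≤ 1 / 2 := by
      rw [div_mul_div_comm, one_mul]
      have := pi_gt_three
      exact one_div_le_one_div_of_le two_pos (by nlinarith)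
    rw [hFre, abs_div, abs_abs, div_le_div_iff₀ hw' (by positivity), ← sq_abs w]
    have h4 : |(fourierT (deriv f) w * (starRingEnd ℂ) (fourierT (deriv g) w)).re| ≤
        ‖fourierT (deriv f) w‖ * ‖fourierT (deriv g) w‖ := by
      refine (Complex.abs_re_le_norm _).trans_eq ?_
      rw [norm_mul, RCLike.norm_conj]
    calc _ ≤ (‖fourierT (deriv f) w‖ * ‖fourierT (deriv g) w‖) * |w| ^ 2 := by gcongr
      _ = ‖fourierT (deriv f) w‖ * (|w| * ‖fourierT (deriv g) w‖) * |w| := by ring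
      _ ≤ (1 / (2 * π) * A) * (1 / (2 * π) * B) * |w| := by gcongr
      _ = (1 / (2 * π) * (1 / (2 * π))) * (A * B * |w|) := by ring
      _ ≤ 1 / 2 * (A * B * |w|) := by gcongr
      _ = _ := by ring
  have hlim := tendsto_setIntegral_fourierT hf' hg'.continuous hfs.deriv hgs.deriv h0
  simp_rw [← hFre] at hlim
  rw [← hre, abs_sub_comm]
  refine le_of_tendsto (hlim.sub_const _).abs ?_
  filter_upwards [eventually_ge_atTop α] with b hb
  refine (abs_setIntegral_Icc_sub_le (Complex.continuous_re.comp hFc) hbound hα hb).trans_eq ?_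
  ring

lemma smoothedInd_Icc (φ : ℝ → ℝ) (ε : ℝ) {u : ℝ} (hu : 0 ≤ u) (x : ℝ) :
    smoothedInd φ ε (Icc 0 u) x = ∫ y in (x - u)..x, ε⁻¹ * φ (y / ε) := by
  rw [intervalIntegral.integral_of_le (by linarith), ← integral_Icc_eq_integral_Ioc,
    ← integral_indicator measurableSet_Icc, smoothedInd]
  congr 1 with y
  by_cases hy : y ∈ Icc (x - u) x
  · rw [indicator_of_mem hy, indicator_of_mem
      (show x - y ∈ Icc 0 u from ⟨by linarith [hy.2], by linarith [hy.1]⟩), one_mul]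
  · rw [indicator_of_notMem hy, indicator_of_notMem, zero_mul]
    exact fun h => hy ⟨by linarith [h.2], by linarith [h.1]⟩

lemma hasDerivAt_integral_sub_left {ψ : ℝ → ℝ} (hψ : Continuous ψ) (u x : ℝ) :
    HasDerivAt (fun x => ∫ y in (x - u)..x, ψ y) (ψ x - ψ (x - u)) x := by
  have hd : ∀ x, HasDerivAt (fun x => ∫ y in (0 : ℝ)..x, ψ y) (ψ x) x := fun x =>
    (hψ.integral_hasStrictDerivAt 0 x).hasDerivAt
  refine ((hd x).sub ((hd (x - u)).comp_sub_const x u)).congr_of_eventuallyEq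
    (Eventually.of_forall fun t => ?_)
  exact (intervalIntegral.integral_interval_sub_left (hψ.intervalIntegrable _ _)
    (hψ.intervalIntegrable _ _)).symm

lemma hasCompactSupport_integral_sub_left {ψ : ℝ → ℝ} (hψ : HasCompactSupport ψ) {u : ℝ}
    (hu : 0 ≤ u) : HasCompactSupport fun x => ∫ y in (x - u)..x, ψ y := by
  obtain ⟨R, hR⟩ := exists_forall_eq_zero_of_hasCompactSupport hψ
  refine HasCompactSupport.intro (isCompact_Icc (a := -R) (b := R + u)) fun x hx => ?_
  rw [← intervalIntegral.integral_zero (a := x - u) (b := x)]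
  refine intervalIntegral.integral_congr fun y hy => hR y ?_
  rw [uIcc_of_le (by linarith)] at hy
  by_contra! hyR
  rw [abs_le] at hyR
  exact hx ⟨by linarith [hy.2], by linarith [hy.1]⟩

lemma integral_abs_sub_comp_sub_le {ψ : ℝ → ℝ} (hψ : Integrable ψ) (u : ℝ) :
    ∫ x, |ψ x - ψ (x - u)| ≤ 2 * ∫ x, |ψ x| := by
  have h1 := hψ.comp_sub_right u
  calc ∫ x, |ψ x - ψ (x - u)| ≤ ∫ x, (|ψ x| + |ψ (x - u)|) :=
        integral_mono (hψ.sub h1).abs (hψ.abs.add h1.abs) fun x => abs_sub _ _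
    _ = _ := by
        rw [integral_add hψ.abs h1.abs, integral_sub_right_eq_self (fun x => |ψ x|), two_mul]

lemma integral_abs_const_mul_comp_div (φ : ℝ → ℝ) (c : ℝ) {ε : ℝ} (hε : 0 < ε) :
    ∫ x, |c * φ (x / ε)| = |c| * ε * ∫ x, |φ x| := by
  simp_rw [abs_mul]
  rw [integral_const_mul, Measure.integral_comp_div (fun x => |φ x|), abs_of_pos hε, smul_eq_mul,
    mul_assoc]

lemma hasCompactSupport_const_mul_comp_div {φ : ℝ → ℝ} (hφ : HasCompactSupport φ) (c : ℝ) {ε : ℝ}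
    (hε : ε ≠ 0) : HasCompactSupport fun x => c * φ (x / ε) := by
  have h : HasCompactSupport fun x => φ (x / ε) :=
    hφ.comp_homeomorph (Homeomorph.mulRight₀ ε⁻¹ (inv_ne_zero hε))
  exact h.mul_left

theorem stmt_10 (φ : ℝ → ℝ) (hφ : ContDiff ℝ (⊤ : ℕ∞) φ)
    (hsupp : Function.support φ ⊆ Set.Ioo (-(1/2)) (1/2))
    (hnorm : ∫ x : ℝ, φ x = 1)
    (u v : ℝ) (hu0 : 0 < u) (hu1 : u < 1) (hv0 : 0 < v) (hv1 : v < 1) :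
    ∃ C > 0, ∀ α : ℝ, 1 ≤ α → ∀ ε : ℝ, 0 < ε → ε < 1 → ε < min u v / 2 →
      |(∫ w in Set.Icc (-α) α,
          ((|w| : ℝ) : ℂ) * fourierT (smoothedInd φ ε (Set.Icc 0 u)) w *
            (starRingEnd ℂ) (fourierT (smoothedInd φ ε (Set.Icc 0 v)) w)).re -
        scalarProd (smoothedInd φ ε (Set.Icc 0 u)) (smoothedInd φ ε (Set.Icc 0 v))|
        ≤ C / (α * ε) := by
  have hφs : HasCompactSupport φ :=
    isCompact_Icc.of_isClosed_subset (isClosed_tsupport φ)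
      (closure_minimal (hsupp.trans Ioo_subset_Icc_self) isClosed_Icc)
  have hA : 0 ≤ ∫ x, |φ x| := integral_nonneg fun x => abs_nonneg _
  have hB : 0 ≤ ∫ x, |deriv φ x| := integral_nonneg fun x => abs_nonneg _
  refine ⟨4 * (∫ x, |φ x|) * (∫ x, |deriv φ x|) + 1, by positivity,
    fun α hα ε hε _ _ => ?_⟩
  have hα0 : 0 < α := by linarith
  set ψ : ℝ → ℝ := fun y => ε⁻¹ * φ (y / ε) with hψdef
  have hψ : ContDiff ℝ 1 ψ := by
    have : ContDiff ℝ 1 φ := hφ.of_le (by exact_mod_cast le_top)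
    fun_prop
  have hψs : HasCompactSupport ψ := hasCompactSupport_const_mul_comp_div hφs _ hε.ne'
  have hdψ : ∀ x, deriv ψ x = ε⁻¹ * ε⁻¹ * deriv φ (x / ε) := fun x => by
    have h1 : HasDerivAt φ (deriv φ (x / ε)) (x / ε) :=
      (hφ.differentiable (by simp) _).hasDerivAt
    have h2 := ((h1.comp x ((hasDerivAt_id x).div_const ε)).const_mul ε⁻¹).deriv
    rw [show ψ = fun y => ε⁻¹ * (φ ∘ fun x => id x / ε) y from rfl, h2]
    ring
  have hd : ∀ u : ℝ, deriv (fun x => ∫ y in (x - u)..x, ψ y) = fun x => ψ x - ψ (x - u) :=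
    fun u => funext fun x => (hasDerivAt_integral_sub_left hψ.continuous u x).deriv
  have hdd : ∀ u : ℝ, deriv (fun x => ψ x - ψ (x - u)) = fun x => deriv ψ x - deriv ψ (x - u) :=
    fun u => funext fun x => by
      have h1 := fun x => (hψ.differentiable one_ne_zero x).hasDerivAt
      exact ((h1 x).sub ((h1 (x - u)).comp_sub_const x u)).deriv
  have hC : ∀ u : ℝ, ContDiff ℝ 2 fun x => ∫ y in (x - u)..x, ψ y := fun u => by
    refine (contDiff_succ_iff_deriv (n := 1)).2
      ⟨fun x => (hasDerivAt_integral_sub_left hψ.continuous u x).differentiableAt, by simp, ?_⟩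
    rw [hd]
    fun_prop
  have hψi := hψ.continuous.integrable_of_hasCompactSupport (μ := volume) hψs
  have hψi' := (hψ.continuous_deriv le_rfl).integrable_of_hasCompactSupport (μ := volume) hψs.deriv
  have hA' : ∫ x, |ψ x| = ∫ x, |φ x| := by
    rw [hψdef, integral_abs_const_mul_comp_div φ _ hε, abs_of_pos (inv_pos.2 hε),
      inv_mul_cancel₀ hε.ne', one_mul]
  have hB' : ∫ x, |deriv ψ x| = ε⁻¹ * ∫ x, |deriv φ x| := by
    simp_rw [hdψ]
    rw [integral_abs_const_mul_comp_div _ _ hε, abs_of_pos (by positivity),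
      inv_mul_cancel_right₀ hε.ne']
  rw [funext (smoothedInd_Icc φ ε hu0.le), funext (smoothedInd_Icc φ ε hv0.le)]
  refine (abs_re_setIntegral_fourierT_sub_scalarProd_le (hC u) (hC v)
    (hasCompactSupport_integral_sub_left hψs hu0.le)
    (hasCompactSupport_integral_sub_left hψs hv0.le) hα0).trans ?_
  rw [hd, hd, hdd]
  have h1 := (integral_abs_sub_comp_sub_le hψi u).trans_eq (by rw [hA'])
  have h2 := (integral_abs_sub_comp_sub_le hψi' v).trans_eq (by rw [hB'])
  calc _ ≤ (2 * ∫ x, |φ x|) * (2 * (ε⁻¹ * ∫ x, |deriv φ x|)) / α := by gcongr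
    _ = 4 * (∫ x, |φ x|) * (∫ x, |deriv φ x|) / (α * ε) := by field_simp; ring
    _ ≤ _ := by gcongr; linarith
end

section
/- For every real y with y ≠ 0, the improper integral lim_{T→∞} ∫_0^T (cos w − cos(w·y))/w dw exists and equals log|y| (the integrand is extended continuously by the value 0 at w = 0). -/
open MeasureTheory Real Filter

/-- The function `w ↦ (1 - cos w) / w` agrees everywhere with a continuous function. -/
lemma one_sub_cos_div_eq_sinc_mul_sin (w : ℝ) :
    (1 - Real.cos w) / w = Real.sinc (w / 2) * Real.sin (w / 2) := by
  rcases eq_or_ne w 0 with rfl | hw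
  · simp
  · rw [Real.sinc_of_ne_zero (by positivity)]
    have h := Real.cos_sq' (w / 2)
    have h2 := Real.cos_sq (w / 2)
    rw [mul_div_cancel₀ w two_ne_zero] at h2
    field_simp
    linarith

lemma continuous_one_sub_cos_div : Continuous fun w : ℝ => (1 - Real.cos w) / w := by
  simp_rw [one_sub_cos_div_eq_sinc_mul_sin]
  have := Real.continuous_sinc
  fun_prop

lemma integral_cos_div_eq {a b : ℝ} (ha : 0 < a) (hb : 0 < b) :
    ∫ w in a..b, Real.cos w / w =
      Real.sin b / b - Real.sin a / a + ∫ w in a..b, Real.sin w / w ^ 2 := by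
  have hne : ∀ w ∈ Set.uIcc a b, w ≠ 0 := fun w hw =>
    (lt_of_lt_of_le (lt_min ha hb) hw.1).ne'
  have hs : IntervalIntegrable (fun w : ℝ => Real.sin w / w ^ 2) volume a b :=
    ContinuousOn.intervalIntegrable <|
      Real.continuous_sin.continuousOn.div (by fun_prop) fun w hw => pow_ne_zero 2 (hne w hw)
  have hc : IntervalIntegrable (fun w : ℝ => Real.cos w / w) volume a b :=
    ContinuousOn.intervalIntegrable <|
      Real.continuous_cos.continuousOn.div continuousOn_id hne
  have key := intervalIntegral.integral_eq_sub_of_hasDerivAt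
    (f := fun w => Real.sin w / w) (f' := fun w => Real.cos w / w - Real.sin w / w ^ 2)
    (fun w hw => by
      have hw0 := hne w hw
      refine HasDerivAt.congr_deriv ((Real.hasDerivAt_sin w).fun_div (hasDerivAt_id' w) hw0) ?_
      field_simp) (hc.sub hs)
  rw [intervalIntegral.integral_sub hc hs] at key
  linarith

lemma tendsto_sin_div_atTop : Tendsto (fun T : ℝ => Real.sin T / T) atTop (nhds 0) :=
  squeeze_zero_norm' (a := fun T : ℝ => T⁻¹)
    (by
      filter_upwards [eventually_gt_atTop 0] with T hT
      rw [norm_div, Real.norm_of_nonneg hT.le, Real.norm_eq_abs, inv_eq_one_div]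
      gcongr
      exact Real.abs_sin_le_one T)
    tendsto_inv_atTop_zero

lemma tendsto_integral_sin_div_sq {c : ℝ} (hc : 0 < c) :
    Tendsto (fun T : ℝ => ∫ w in T..(c * T), Real.sin w / w ^ 2) atTop (nhds 0) := by
  have hm : 0 < min 1 c := lt_min one_pos hc
  refine squeeze_zero_norm' (a := fun T : ℝ => (1 / min 1 c ^ 2 * |c - 1|) * T⁻¹) ?_
    (mul_zero (1 / min 1 c ^ 2 * |c - 1|) ▸
      tendsto_inv_atTop_zero.const_mul (1 / min 1 c ^ 2 * |c - 1|))
  filter_upwards [eventually_gt_atTop 0] with T hT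
  have hbound : ∀ w ∈ Set.uIoc T (c * T),
      ‖Real.sin w / w ^ 2‖ ≤ 1 / (min 1 c * T) ^ 2 := by
    intro w hw
    have hle : min 1 c * T ≤ w := by
      have := hw.1.le
      rwa [min_mul_of_nonneg _ _ hT.le, one_mul]
    rw [norm_div, norm_pow, Real.norm_eq_abs, Real.norm_eq_abs, sq_abs]
    gcongr
    exact Real.abs_sin_le_one w
  refine (intervalIntegral.norm_integral_le_of_norm_le_const hbound).trans_eq ?_
  rw [show c * T - T = (c - 1) * T by ring, abs_mul, abs_of_pos hT]
  field_simp

lemma tendsto_integral_cos_div {c : ℝ} (hc : 0 < c) :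
    Tendsto (fun T : ℝ => ∫ w in T..(c * T), Real.cos w / w) atTop (nhds 0) := by
  have h := ((tendsto_sin_div_atTop.comp (tendsto_id.const_mul_atTop hc)).sub
    tendsto_sin_div_atTop).add (tendsto_integral_sin_div_sq hc)
  rw [sub_zero, add_zero] at h
  refine h.congr' ?_
  filter_upwards [eventually_gt_atTop 0] with T hT
  exact (integral_cos_div_eq hT (mul_pos hc hT)).symm

lemma integral_cos_sub_cos_mul_div {c T : ℝ} (hc : 0 < c) (hT : 0 < T) :
    ∫ w in (0:ℝ)..T, (Real.cos w - Real.cos (w * c)) / w =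
      Real.log c - ∫ w in T..(c * T), Real.cos w / w := by
  have hg := continuous_one_sub_cos_div
  have hcT : 0 < c * T := mul_pos hc hT
  have hne : ∀ w ∈ Set.uIcc T (c * T), w ≠ 0 := fun w hw =>
    (lt_of_lt_of_le (lt_min hT hcT) hw.1).ne'
  have hsplit : ∀ w : ℝ, (Real.cos w - Real.cos (w * c)) / w =
      c * ((1 - Real.cos (c * w)) / (c * w)) - (1 - Real.cos w) / w := by
    intro w
    rw [mul_div_assoc', mul_div_mul_left _ _ hc.ne', mul_comm w c]
    ring
  have hscale : ∫ w in (0:ℝ)..T, c * ((1 - Real.cos (c * w)) / (c * w)) =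
      ∫ w in (0:ℝ)..(c * T), (1 - Real.cos w) / w := by
    rw [intervalIntegral.integral_const_mul,
      intervalIntegral.mul_integral_comp_mul_left (f := fun w => (1 - Real.cos w) / w), mul_zero]
  have hinv : IntervalIntegrable (fun w : ℝ => 1 / w) volume T (c * T) :=
    ContinuousOn.intervalIntegrable <| continuousOn_const.div continuousOn_id hne
  have hcos : IntervalIntegrable (fun w : ℝ => Real.cos w / w) volume T (c * T) :=
    ContinuousOn.intervalIntegrable <|
      Real.continuous_cos.continuousOn.div continuousOn_id hne
  have hgc : Continuous fun w : ℝ => c * ((1 - Real.cos (c * w)) / (c * w)) :=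
    continuous_const.mul (hg.comp (continuous_const.mul continuous_id))
  simp_rw [hsplit]
  rw [intervalIntegral.integral_sub (hgc.intervalIntegrable _ _)
      (hg.intervalIntegrable _ _), hscale,
    intervalIntegral.integral_interval_sub_left (hg.intervalIntegrable _ _)
      (hg.intervalIntegrable _ _)]
  simp_rw [sub_div]
  rw [intervalIntegral.integral_sub hinv hcos, integral_one_div_of_pos hT hcT,
    mul_div_cancel_right₀ _ hT.ne']

theorem stmt_12 (y : ℝ) (hy : y ≠ 0) :
    Tendsto (fun T : ℝ =>
        ∫ w in (0:ℝ)..T, (Real.cos w - Real.cos (w * y)) / w)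
      atTop (nhds (Real.log |y|)) := by
  have hpos : 0 < |y| := abs_pos.mpr hy
  have habs : ∀ w : ℝ, Real.cos (w * y) = Real.cos (w * |y|) := by
    intro w
    rcases abs_choice y with h | h <;> rw [h]
    rw [mul_neg, Real.cos_neg]
  simp_rw [habs]
  have h := (tendsto_integral_cos_div hpos).const_sub (Real.log |y|)
  rw [sub_zero] at h
  refine h.congr' ?_
  filter_upwards [eventually_gt_atTop 0] with T hT
  exact (integral_cos_sub_cos_mul_div hpos hT).symm
end

section
/- Let τ > 0 and b₀, b₁, b₂ > 0. Then there exists a Borel probability measure β on the interval (0, 1] such that for every real q > −b₀ one has ∫_{(0,1]} x^q dβ(x) = exp( ∫_0^∞ (e^{−xq} − 1) · e^{−b₀ x} · (1 − e^{−b₁ x})(1 − e^{−b₂ x}) / ( (1 − e^{−x})(1 − e^{−τ x}) ) · dx/x ), where the inner integral converges absolutely. -/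
open MeasureTheory Real

/-- The Lévy–Khinchine integrand of the Barnes beta distribution of type (2,2). -/
noncomputable def barnesLK (τ b₀ b₁ b₂ q x : ℝ) : ℝ :=
  (Real.exp (-(x * q)) - 1) * Real.exp (-(b₀ * x)) *
    ((1 - Real.exp (-(b₁ * x))) * (1 - Real.exp (-(b₂ * x)))) /
      ((1 - Real.exp (-x)) * (1 - Real.exp (-(τ * x)))) / x

open Set Filter Topology
open scoped ENNReal Nat

/-- The two-sided Laplace transform `∫ exp (-(x * q)) dμ(x)` as an extended nonnegative real. -/
noncomputable def laplaceLIntegral (μ : Measure ℝ) (q : ℝ) : ℝ≥0∞ :=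
  ∫⁻ x, ENNReal.ofReal (Real.exp (-(x * q))) ∂μ

/-- The `n`-fold convolution power of a measure. -/
noncomputable def convPow (ν : Measure ℝ) : ℕ → Measure ℝ
  | 0 => Measure.dirac 0
  | n + 1 => (convPow ν n).conv ν

/-- The compound Poisson distribution with finite Lévy measure `ν`. -/
noncomputable def compoundPoisson (ν : Measure ℝ) : Measure ℝ :=
  ENNReal.ofReal (Real.exp (-ν.real univ)) •
    Measure.sum fun n : ℕ => ENNReal.ofReal (1 / (n ! : ℝ)) • convPow ν n

lemma laplaceLIntegral_conv (μ ν : Measure ℝ) [SFinite ν] (q : ℝ) :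
    laplaceLIntegral (μ.conv ν) q = laplaceLIntegral μ q * laplaceLIntegral ν q := by
  unfold laplaceLIntegral
  rw [Measure.lintegral_conv (by fun_prop), ← lintegral_mul_const _ (by fun_prop)]
  refine lintegral_congr fun x => ?_
  rw [← lintegral_const_mul _ (by fun_prop)]
  refine lintegral_congr fun y => ?_
  rw [← ENNReal.ofReal_mul (Real.exp_nonneg _), ← Real.exp_add]
  ring_nf

lemma laplaceLIntegral_zero (μ : Measure ℝ) : laplaceLIntegral μ 0 = μ univ := by
  simp [laplaceLIntegral]

lemma laplaceLIntegral_convPow (ν : Measure ℝ) [SFinite ν] (q : ℝ) (n : ℕ) :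
    laplaceLIntegral (convPow ν n) q = laplaceLIntegral ν q ^ n := by
  induction n with
  | zero => simp [laplaceLIntegral, convPow]
  | succ n ih => rw [convPow, laplaceLIntegral_conv, ih, pow_succ]

lemma ae_nonneg_conv {μ ν : Measure ℝ} [SFinite μ] [SFinite ν]
    (hμ : ∀ᵐ x ∂μ, 0 ≤ x) (hν : ∀ᵐ x ∂ν, 0 ≤ x) : ∀ᵐ x ∂μ.conv ν, 0 ≤ x := by
  rw [Measure.conv, ae_map_iff (by fun_prop) measurableSet_Ici]
  filter_upwards [Measure.quasiMeasurePreserving_fst.ae hμ,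
    Measure.quasiMeasurePreserving_snd.ae hν] with z h₁ h₂
  exact add_nonneg h₁ h₂

instance sFinite_convPow (ν : Measure ℝ) [SFinite ν] (n : ℕ) : SFinite (convPow ν n) := by
  induction n with
  | zero => rw [convPow]; infer_instance
  | succ n ih => rw [convPow]; infer_instance

instance sFinite_compoundPoisson (ν : Measure ℝ) [SFinite ν] : SFinite (compoundPoisson ν) := by
  unfold compoundPoisson
  infer_instance

lemma ae_nonneg_convPow {ν : Measure ℝ} [SFinite ν] (hν : ∀ᵐ x ∂ν, 0 ≤ x) (n : ℕ) :
    ∀ᵐ x ∂convPow ν n, 0 ≤ x := by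
  induction n with
  | zero => rw [convPow, ae_dirac_iff measurableSet_Ici]
  | succ n ih => exact ae_nonneg_conv ih hν

lemma ae_nonneg_compoundPoisson {ν : Measure ℝ} [SFinite ν] (hν : ∀ᵐ x ∂ν, 0 ≤ x) :
    ∀ᵐ x ∂compoundPoisson ν, 0 ≤ x := by
  refine Measure.ae_smul_measure ?_ _
  rw [Measure.ae_sum_iff' measurableSet_Ici]
  exact fun n => Measure.ae_smul_measure (ae_nonneg_convPow hν n) _

lemma laplaceLIntegral_compoundPoisson (ν : Measure ℝ) [IsFiniteMeasure ν] {q : ℝ}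
    (hq : Integrable (fun x => Real.exp (-(x * q))) ν) :
    laplaceLIntegral (compoundPoisson ν) q =
      ENNReal.ofReal (Real.exp (∫ x, (Real.exp (-(x * q)) - 1) ∂ν)) := by
  have hL : laplaceLIntegral ν q = ENNReal.ofReal (∫ x, Real.exp (-(x * q)) ∂ν) :=
    (ofReal_integral_eq_lintegral_ofReal hq (ae_of_all _ fun x => Real.exp_nonneg _)).symm
  have hI : 0 ≤ ∫ x, Real.exp (-(x * q)) ∂ν := integral_nonneg fun x => Real.exp_nonneg _
  have hsum := NormedSpace.expSeries_div_hasSum_exp (∫ x, Real.exp (-(x * q)) ∂ν)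
  rw [← Real.exp_eq_exp_ℝ] at hsum
  have h : laplaceLIntegral (compoundPoisson ν) q = ENNReal.ofReal (Real.exp (-ν.real univ)) *
      ∑' n : ℕ, ENNReal.ofReal (1 / (n ! : ℝ)) * laplaceLIntegral (convPow ν n) q := by
    simp only [laplaceLIntegral, compoundPoisson, lintegral_smul_measure, lintegral_sum_measure,
      smul_eq_mul]
  have hterm (n : ℕ) : ENNReal.ofReal (1 / (n ! : ℝ)) * laplaceLIntegral (convPow ν n) q =
      ENNReal.ofReal ((∫ x, Real.exp (-(x * q)) ∂ν) ^ n / n !) := by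
    rw [laplaceLIntegral_convPow, hL, ← ENNReal.ofReal_pow hI,
      ← ENNReal.ofReal_mul (by positivity), one_div_mul_eq_div]
  rw [h, tsum_congr hterm, ← ENNReal.ofReal_tsum_of_nonneg (fun n => by positivity) hsum.summable,
    hsum.tsum_eq, ← ENNReal.ofReal_mul (Real.exp_nonneg _), ← Real.exp_add,
    integral_sub hq (integrable_const _)]
  simp [sub_eq_neg_add]

lemma ae_nonneg_gammaMeasure (a r : ℝ) : ∀ᵐ x ∂ProbabilityTheory.gammaMeasure a r, 0 ≤ x := by
  rw [ae_iff]
  simp only [not_le]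
  rw [ProbabilityTheory.gammaMeasure]
  refine (withDensity_apply _ measurableSet_Iio).trans ?_
  exact ProbabilityTheory.lintegral_gammaPDF_of_nonpos le_rfl

lemma laplaceLIntegral_gammaMeasure {a r q : ℝ} (ha : 0 < a) (hr : 0 < r) (hq : 0 < r + q) :
    laplaceLIntegral (ProbabilityTheory.gammaMeasure a r) q =
      ENNReal.ofReal ((r / (r + q)) ^ a) := by
  have hm : Measurable (ProbabilityTheory.gammaPDF a r) :=
    (ProbabilityTheory.measurable_gammaPDFReal a r).ennreal_ofReal
  have hm' : Measurable (ProbabilityTheory.gammaPDF a (r + q)) :=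
    (ProbabilityTheory.measurable_gammaPDFReal a (r + q)).ennreal_ofReal
  rw [laplaceLIntegral, ProbabilityTheory.gammaMeasure,
    lintegral_withDensity_eq_lintegral_mul _ hm (by fun_prop),
    ← mul_one (ENNReal.ofReal _), ← ProbabilityTheory.lintegral_gammaPDF_eq_one ha hq,
    ← lintegral_const_mul _ hm']
  refine lintegral_congr fun x => ?_
  rcases lt_or_ge x 0 with hx | hx
  · simp [ProbabilityTheory.gammaPDF_of_neg hx]
  · rw [Pi.mul_apply, ProbabilityTheory.gammaPDF_of_nonneg hx,
      ProbabilityTheory.gammaPDF_of_nonneg hx, ← ENNReal.ofReal_mul (by positivity),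
      ← ENNReal.ofReal_mul (by positivity), Real.div_rpow hr.le hq.le,
      show -((r + q) * x) = -(r * x) + -(x * q) by ring, Real.exp_add]
    have := (Real.rpow_pos_of_pos hq a).ne'
    congr 1
    field_simp

lemma one_sub_exp_neg_le (u : ℝ) : 1 - Real.exp (-u) ≤ u := by
  linarith [Real.add_one_le_exp (-u)]

lemma mul_exp_neg_le_one_sub_exp_neg (u : ℝ) : u * Real.exp (-u) ≤ 1 - Real.exp (-u) := by
  have := mul_le_mul_of_nonneg_right (Real.add_one_le_exp u) (Real.exp_nonneg (-u))
  rw [← Real.exp_add] at this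
  simp only [add_neg_cancel, Real.exp_zero] at this
  linarith

lemma one_sub_exp_neg_pos {u : ℝ} (hu : 0 < u) : 0 < 1 - Real.exp (-u) := by
  simpa using hu

lemma abs_exp_neg_sub_one_le (u : ℝ) :
    |Real.exp (-u) - 1| ≤ |u| * (1 + Real.exp (-u)) := by
  have h₁ := Real.add_one_le_exp (-u)
  have h₂ := mul_exp_neg_le_one_sub_exp_neg u
  have h₃ := Real.exp_pos (-u)
  have h₄ := mul_le_mul_of_nonneg_right (neg_abs_le u) h₃.le
  have h₅ := mul_nonneg (abs_nonneg u) h₃.le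
  rw [abs_le]
  constructor <;> nlinarith [le_abs_self u, neg_abs_le u, abs_nonneg u]

lemma integrableOn_exp_neg_mul {s : ℝ} (hs : 0 < s) :
    IntegrableOn (fun x => Real.exp (-(s * x))) (Ioi 0) := by
  simpa using exp_neg_integrableOn_Ioi 0 hs

lemma integrableOn_gamma_levy {r q : ℝ} (hr : 0 < r) (hq : 0 < r + q) :
    IntegrableOn (fun x => (Real.exp (-(x * q)) - 1) * (Real.exp (-(r * x)) / x)) (Ioi 0) := by
  refine Integrable.mono' (((integrableOn_exp_neg_mul hr).add
    (integrableOn_exp_neg_mul hq)).const_mul |q|) (by fun_prop) ?_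
  filter_upwards [ae_restrict_mem measurableSet_Ioi] with x hx
  rw [mem_Ioi] at hx
  have h := mul_le_mul_of_nonneg_right (abs_exp_neg_sub_one_le (x * q))
    (div_nonneg (Real.exp_nonneg (-(r * x))) hx.le)
  rw [Real.norm_eq_abs, abs_mul, abs_of_nonneg (div_nonneg (Real.exp_nonneg (-(r * x))) hx.le)]
  refine h.trans (le_of_eq ?_)
  rw [Pi.add_apply, show -((r + q) * x) = -(r * x) + -(x * q) by ring, Real.exp_add, abs_mul,
    abs_of_pos hx]
  field_simp

lemma integral_gamma_levy {r q : ℝ} (hr : 0 < r) (hq : 0 < r + q) :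
    ∫ x in Ioi 0, (Real.exp (-(x * q)) - 1) * (Real.exp (-(r * x)) / x) =
      Real.log (r / (r + q)) := by
  have heq : (fun x : ℝ => (Real.exp (-(x * q)) - 1) * (Real.exp (-(r * x)) / x)) =
      fun x => x⁻¹ • (Real.exp (-((r + q) * x)) - Real.exp (-(r * x))) := by
    ext x
    rw [show -((r + q) * x) = -(r * x) + -(x * q) by ring, Real.exp_add, smul_eq_mul]
    ring
  have hint := integrableOn_gamma_levy hr hq
  rw [heq] at hint ⊢
  have hc : Continuous fun x : ℝ => Real.exp (-x) := by fun_prop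
  have := Frullani.integral_Ioi_eq (f := fun x : ℝ => Real.exp (-x)) (L := 1) (R := 0)
    (hc.locallyIntegrable.locallyIntegrableOn _) hq hr
    (by simpa using (hc.tendsto 0).mono_left nhdsWithin_le_nhds)
    (Real.tendsto_exp_neg_atTop_nhds_zero) hint
  simpa using this

/-- The Lévy density of the Barnes beta distribution of type (2,2), times `x`. -/
noncomputable def barnesKernel (τ b₀ b₁ b₂ x : ℝ) : ℝ :=
  Real.exp (-(b₀ * x)) * ((1 - Real.exp (-(b₁ * x))) * (1 - Real.exp (-(b₂ * x)))) /
      ((1 - Real.exp (-x)) * (1 - Real.exp (-(τ * x))))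

/-- The part of the Barnes beta Lévy density left over after removing the Lévy density of a gamma
distribution with the same singularity at the origin. -/
noncomputable def barnesRemainder (τ b₀ b₁ b₂ x : ℝ) : ℝ :=
  (barnesKernel τ b₀ b₁ b₂ x - b₁ * b₂ / τ * Real.exp (-((b₀ + b₁ + b₂) * x))) / x

lemma barnesLK_eq (τ b₀ b₁ b₂ q x : ℝ) :
    barnesLK τ b₀ b₁ b₂ q x =
      b₁ * b₂ / τ * ((Real.exp (-(x * q)) - 1) * (Real.exp (-((b₀ + b₁ + b₂) * x)) / x)) +
        (Real.exp (-(x * q)) - 1) * barnesRemainder τ b₀ b₁ b₂ x := by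
  unfold barnesLK barnesRemainder barnesKernel
  ring

lemma barnesRemainder_nonneg {τ b₀ b₁ b₂ x : ℝ} (hτ : 0 < τ) (hb₁ : 0 < b₁) (hb₂ : 0 < b₂)
    (hx : 0 < x) : 0 ≤ barnesRemainder τ b₀ b₁ b₂ x := by
  refine div_nonneg (sub_nonneg.2 ?_) hx.le
  unfold barnesKernel
  have p₁ := one_sub_exp_neg_pos hx
  have p₂ := one_sub_exp_neg_pos (mul_pos hτ hx)
  rw [le_div_iff₀ (mul_pos p₁ p₂),
    show -((b₀ + b₁ + b₂) * x) = -(b₀ * x) + (-(b₁ * x) + -(b₂ * x)) by ring, Real.exp_add,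
    Real.exp_add]
  calc b₁ * b₂ / τ * (Real.exp (-(b₀ * x)) * (Real.exp (-(b₁ * x)) * Real.exp (-(b₂ * x)))) *
        ((1 - Real.exp (-x)) * (1 - Real.exp (-(τ * x))))
      ≤ b₁ * b₂ / τ * (Real.exp (-(b₀ * x)) * (Real.exp (-(b₁ * x)) * Real.exp (-(b₂ * x)))) *
        (x * (τ * x)) := by
        gcongr <;> exact one_sub_exp_neg_le _
    _ = Real.exp (-(b₀ * x)) * ((b₁ * x * Real.exp (-(b₁ * x))) *
        (b₂ * x * Real.exp (-(b₂ * x)))) := by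
        field_simp
    _ ≤ _ := by
        have q₁ := one_sub_exp_neg_pos (mul_pos hb₁ hx)
        gcongr <;> exact mul_exp_neg_le_one_sub_exp_neg _

lemma barnesKernel_le_near_zero {τ b₀ b₁ b₂ x : ℝ} (hτ : 0 < τ) (hb₁ : 0 < b₁) (hb₂ : 0 < b₂)
    (hx : 0 < x) : barnesKernel τ b₀ b₁ b₂ x ≤
      b₁ * b₂ / τ * (Real.exp (-(b₀ * x)) * Real.exp ((1 + τ) * x)) := by
  have q₁ := one_sub_exp_neg_pos (mul_pos hb₁ hx)
  have q₂ := one_sub_exp_neg_pos (mul_pos hb₂ hx)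
  calc barnesKernel τ b₀ b₁ b₂ x
      ≤ Real.exp (-(b₀ * x)) * ((b₁ * x) * (b₂ * x)) /
        ((x * Real.exp (-x)) * ((τ * x) * Real.exp (-(τ * x)))) := by
        unfold barnesKernel
        have p₁ := one_sub_exp_neg_pos hx
        gcongr
        all_goals first | exact one_sub_exp_neg_le _ | exact mul_exp_neg_le_one_sub_exp_neg _
    _ = _ := by
        rw [show (1 + τ) * x = x + τ * x by ring, Real.exp_add, Real.exp_neg x,
          Real.exp_neg (τ * x)]
        field_simp

lemma barnesKernel_le_of_one_le {τ b₀ b₁ b₂ x : ℝ} (hτ : 0 < τ) (hb₁ : 0 < b₁) (hb₂ : 0 < b₂)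
    (hx : 1 ≤ x) : barnesKernel τ b₀ b₁ b₂ x ≤
      1 / ((1 - Real.exp (-1)) * (1 - Real.exp (-τ))) * Real.exp (-(b₀ * x)) := by
  have hx0 : 0 < x := by linarith
  have q₁ := one_sub_exp_neg_pos (mul_pos hb₁ hx0)
  have q₂ := one_sub_exp_neg_pos (mul_pos hb₂ hx0)
  have p₁ := one_sub_exp_neg_pos one_pos
  have p₂ := one_sub_exp_neg_pos hτ
  calc barnesKernel τ b₀ b₁ b₂ x
      ≤ Real.exp (-(b₀ * x)) * (1 * 1) / ((1 - Real.exp (-1)) * (1 - Real.exp (-τ))) := by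
        unfold barnesKernel
        have p₃ := one_sub_exp_neg_pos hx0
        gcongr
        · linarith [Real.exp_pos (-(b₁ * x))]
        · linarith [Real.exp_pos (-(b₂ * x))]
        · exact le_mul_of_one_le_right hτ.le hx
    _ = _ := by ring

lemma exists_barnesRemainder_le {τ b₁ b₂ : ℝ} (b₀ : ℝ) (hτ : 0 < τ) (hb₁ : 0 < b₁)
    (hb₂ : 0 < b₂) :
    ∃ K, ∀ x, 0 < x → barnesRemainder τ b₀ b₁ b₂ x ≤ K * Real.exp (-(b₀ * x)) := by
  refine ⟨max (b₁ * b₂ / τ * ((1 + τ + b₁ + b₂) * Real.exp (1 + τ)))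
    (1 / ((1 - Real.exp (-1)) * (1 - Real.exp (-τ)))), fun x hx => ?_⟩
  have hc : 0 < b₁ * b₂ / τ := by positivity
  have he := Real.exp_pos (-(b₀ * x))
  rcases le_total x 1 with h1 | h1
  · refine le_trans ?_ (mul_le_mul_of_nonneg_right (le_max_left _ _) he.le)
    rw [barnesRemainder, div_le_iff₀ hx]
    have hk := barnesKernel_le_near_zero (b₀ := b₀) hτ hb₁ hb₂ hx
    have hdiff : Real.exp ((1 + τ) * x) - Real.exp (-((b₁ + b₂) * x)) ≤
        (1 + τ + b₁ + b₂) * x * Real.exp (1 + τ) := by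
      have h := mul_le_mul_of_nonneg_right (one_sub_exp_neg_le ((1 + τ + b₁ + b₂) * x))
        (Real.exp_nonneg ((1 + τ) * x))
      rw [sub_mul, ← Real.exp_add] at h
      have hle : Real.exp ((1 + τ) * x) ≤ Real.exp (1 + τ) := by
        rw [Real.exp_le_exp]; nlinarith
      calc _ = 1 * Real.exp ((1 + τ) * x) -
            Real.exp (-((1 + τ + b₁ + b₂) * x) + (1 + τ) * x) := by ring_nf
        _ ≤ _ := h
        _ ≤ _ := by gcongr
    have hm := mul_le_mul_of_nonneg_left hdiff (mul_pos hc he).le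
    rw [show -((b₀ + b₁ + b₂) * x) = -(b₀ * x) + -((b₁ + b₂) * x) by ring, Real.exp_add]
    linarith
  · refine le_trans ?_ (mul_le_mul_of_nonneg_right (le_max_right _ _) he.le)
    refine le_trans ?_ (barnesKernel_le_of_one_le hτ hb₁ hb₂ h1)
    have hn := barnesRemainder_nonneg (b₀ := b₀) hτ hb₁ hb₂ hx
    have hg : 0 ≤ b₁ * b₂ / τ * Real.exp (-((b₀ + b₁ + b₂) * x)) := by positivity
    have hmul : barnesRemainder τ b₀ b₁ b₂ x * x = barnesKernel τ b₀ b₁ b₂ x -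
        b₁ * b₂ / τ * Real.exp (-((b₀ + b₁ + b₂) * x)) := div_mul_cancel₀ _ hx.ne'
    nlinarith

@[fun_prop]
lemma measurable_barnesRemainder (τ b₀ b₁ b₂ : ℝ) : Measurable (barnesRemainder τ b₀ b₁ b₂) := by
  unfold barnesRemainder barnesKernel
  fun_prop

lemma integrableOn_exp_mul_barnesRemainder {τ b₀ b₁ b₂ q : ℝ} (hτ : 0 < τ) (hb₁ : 0 < b₁)
    (hb₂ : 0 < b₂) (hq : 0 < b₀ + q) :
    IntegrableOn (fun x => Real.exp (-(x * q)) * barnesRemainder τ b₀ b₁ b₂ x) (Ioi 0) := by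
  obtain ⟨K, hK⟩ := exists_barnesRemainder_le b₀ hτ hb₁ hb₂
  refine Integrable.mono' ((integrableOn_exp_neg_mul hq).const_mul K)
    (by fun_prop) ?_
  filter_upwards [ae_restrict_mem measurableSet_Ioi] with x hx
  have hn := barnesRemainder_nonneg (b₀ := b₀) hτ hb₁ hb₂ hx
  rw [Real.norm_eq_abs, abs_of_nonneg (by positivity),
    show -((b₀ + q) * x) = -(b₀ * x) + -(x * q) by ring, Real.exp_add]
  have := mul_le_mul_of_nonneg_left (hK x hx) (Real.exp_nonneg (-(x * q)))
  linarith

/-- The finite measure with density `barnesRemainder` on the positive half-line. -/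
noncomputable def barnesRemainderMeasure (τ b₀ b₁ b₂ : ℝ) : Measure ℝ :=
  (volume.restrict (Ioi 0)).withDensity fun x => ENNReal.ofReal (barnesRemainder τ b₀ b₁ b₂ x)

lemma ae_nonneg_barnesRemainderMeasure (τ b₀ b₁ b₂ : ℝ) :
    ∀ᵐ x ∂barnesRemainderMeasure τ b₀ b₁ b₂, 0 ≤ x := by
  refine (withDensity_absolutelyContinuous _ _).ae_le ?_
  filter_upwards [ae_restrict_mem measurableSet_Ioi] with x hx using le_of_lt hx

lemma isFiniteMeasure_barnesRemainderMeasure {τ b₀ b₁ b₂ : ℝ} (hτ : 0 < τ) (hb₀ : 0 < b₀)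
    (hb₁ : 0 < b₁) (hb₂ : 0 < b₂) : IsFiniteMeasure (barnesRemainderMeasure τ b₀ b₁ b₂) := by
  refine isFiniteMeasure_withDensity_ofReal ?_
  have := integrableOn_exp_mul_barnesRemainder (b₀ := b₀) (q := 0) hτ hb₁ hb₂ (by simpa)
  simp only [mul_zero, neg_zero, Real.exp_zero, one_mul] at this
  exact this.2

lemma toReal_barnesRemainder_smul_ae_eq {τ b₀ b₁ b₂ : ℝ} (hτ : 0 < τ) (hb₁ : 0 < b₁)
    (hb₂ : 0 < b₂) (f : ℝ → ℝ) :
    (fun x => (ENNReal.ofReal (barnesRemainder τ b₀ b₁ b₂ x)).toReal • f x)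
      =ᵐ[volume.restrict (Ioi 0)] fun x => f x * barnesRemainder τ b₀ b₁ b₂ x := by
  filter_upwards [ae_restrict_mem measurableSet_Ioi] with x hx
  rw [ENNReal.toReal_ofReal (barnesRemainder_nonneg hτ hb₁ hb₂ hx), smul_eq_mul, mul_comm]

lemma integrable_barnesRemainderMeasure_iff {τ b₀ b₁ b₂ : ℝ} (hτ : 0 < τ) (hb₁ : 0 < b₁)
    (hb₂ : 0 < b₂) (f : ℝ → ℝ) :
    Integrable f (barnesRemainderMeasure τ b₀ b₁ b₂) ↔
      IntegrableOn (fun x => f x * barnesRemainder τ b₀ b₁ b₂ x) (Ioi 0) := by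
  rw [barnesRemainderMeasure, integrable_withDensity_iff_integrable_smul' (by fun_prop) (by simp)]
  exact integrable_congr (toReal_barnesRemainder_smul_ae_eq hτ hb₁ hb₂ f)

lemma integral_barnesRemainderMeasure {τ b₀ b₁ b₂ : ℝ} (hτ : 0 < τ) (hb₁ : 0 < b₁)
    (hb₂ : 0 < b₂) (f : ℝ → ℝ) :
    ∫ x, f x ∂barnesRemainderMeasure τ b₀ b₁ b₂ =
      ∫ x in Ioi 0, f x * barnesRemainder τ b₀ b₁ b₂ x := by
  rw [barnesRemainderMeasure, integral_withDensity_eq_integral_toReal_smul (by fun_prop) (by simp)]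
  exact integral_congr_ae (toReal_barnesRemainder_smul_ae_eq hτ hb₁ hb₂ f)

/-- The law of `-log X` for `X` a Barnes beta variable of type (2,2): the convolution of a gamma
distribution and a compound Poisson distribution. -/
noncomputable def barnesLogMeasure (τ b₀ b₁ b₂ : ℝ) : Measure ℝ :=
  (ProbabilityTheory.gammaMeasure (b₁ * b₂ / τ) (b₀ + b₁ + b₂)).conv
    (compoundPoisson (barnesRemainderMeasure τ b₀ b₁ b₂))

lemma integrableOn_sub_one_mul_barnesRemainder {τ b₀ b₁ b₂ q : ℝ} (hτ : 0 < τ) (hb₀ : 0 < b₀)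
    (hb₁ : 0 < b₁) (hb₂ : 0 < b₂) (hq : -b₀ < q) :
    IntegrableOn (fun x => (Real.exp (-(x * q)) - 1) * barnesRemainder τ b₀ b₁ b₂ x) (Ioi 0) := by
  have h₁ := integrableOn_exp_mul_barnesRemainder (b₀ := b₀) (q := q) hτ hb₁ hb₂ (by linarith)
  have h₀ := integrableOn_exp_mul_barnesRemainder (b₀ := b₀) (q := 0) hτ hb₁ hb₂ (by linarith)
  refine (h₁.sub h₀).congr (ae_of_all _ fun x => ?_)
  simp [sub_mul]

lemma integrableOn_barnesLK {τ b₀ b₁ b₂ q : ℝ} (hτ : 0 < τ) (hb₀ : 0 < b₀)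
    (hb₁ : 0 < b₁) (hb₂ : 0 < b₂) (hq : -b₀ < q) :
    IntegrableOn (barnesLK τ b₀ b₁ b₂ q) (Ioi 0) := by
  rw [funext (barnesLK_eq τ b₀ b₁ b₂ q)]
  exact ((integrableOn_gamma_levy (by linarith) (by linarith)).const_mul _).add
    (integrableOn_sub_one_mul_barnesRemainder hτ hb₀ hb₁ hb₂ hq)

lemma laplaceLIntegral_barnesLogMeasure {τ b₀ b₁ b₂ q : ℝ} (hτ : 0 < τ) (hb₀ : 0 < b₀)
    (hb₁ : 0 < b₁) (hb₂ : 0 < b₂) (hq : -b₀ < q) :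
    laplaceLIntegral (barnesLogMeasure τ b₀ b₁ b₂) q =
      ENNReal.ofReal (Real.exp (∫ x in Ioi 0, barnesLK τ b₀ b₁ b₂ q x)) := by
  have := isFiniteMeasure_barnesRemainderMeasure hτ hb₀ hb₁ hb₂
  have hr : 0 < b₀ + b₁ + b₂ := by linarith
  have hrq : 0 < b₀ + b₁ + b₂ + q := by linarith
  rw [barnesLogMeasure, laplaceLIntegral_conv,
    laplaceLIntegral_gammaMeasure (by positivity) hr hrq,
    laplaceLIntegral_compoundPoisson _ ((integrable_barnesRemainderMeasure_iff hτ hb₁ hb₂ _).2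
      (integrableOn_exp_mul_barnesRemainder hτ hb₁ hb₂ (by linarith))),
    ← ENNReal.ofReal_mul (by positivity), Real.rpow_def_of_pos (by positivity), ← Real.exp_add,
    integral_barnesRemainderMeasure hτ hb₁ hb₂, funext (barnesLK_eq τ b₀ b₁ b₂ q),
    integral_add ((integrableOn_gamma_levy hr hrq).const_mul _)
      (integrableOn_sub_one_mul_barnesRemainder hτ hb₀ hb₁ hb₂ hq),
    integral_const_mul, integral_gamma_levy hr hrq, mul_comm (Real.log _)]

lemma isProbabilityMeasure_barnesLogMeasure {τ b₀ b₁ b₂ : ℝ} (hτ : 0 < τ) (hb₀ : 0 < b₀)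
    (hb₁ : 0 < b₁) (hb₂ : 0 < b₂) : IsProbabilityMeasure (barnesLogMeasure τ b₀ b₁ b₂) := by
  constructor
  rw [← laplaceLIntegral_zero, laplaceLIntegral_barnesLogMeasure hτ hb₀ hb₁ hb₂ (by linarith)]
  simp [barnesLK]

lemma ae_nonneg_barnesLogMeasure {τ b₀ b₁ b₂ : ℝ} (hτ : 0 < τ) (hb₀ : 0 < b₀)
    (hb₁ : 0 < b₁) (hb₂ : 0 < b₂) : ∀ᵐ x ∂barnesLogMeasure τ b₀ b₁ b₂, 0 ≤ x := by
  have := isFiniteMeasure_barnesRemainderMeasure hτ hb₀ hb₁ hb₂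
  have hr : 0 < b₀ + b₁ + b₂ := by linarith
  have := ProbabilityTheory.isProbabilityMeasure_gammaMeasure
    (a := b₁ * b₂ / τ) (by positivity) hr
  exact ae_nonneg_conv (ae_nonneg_gammaMeasure _ _)
    (ae_nonneg_compoundPoisson (ae_nonneg_barnesRemainderMeasure _ _ _ _))

theorem stmt_13 (τ b₀ b₁ b₂ : ℝ) (hτ : 0 < τ) (hb₀ : 0 < b₀) (hb₁ : 0 < b₁) (hb₂ : 0 < b₂) :
    ∃ β : Measure ℝ, IsProbabilityMeasure β ∧ β (Set.Ioc 0 1)ᶜ = 0 ∧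
      ∀ q : ℝ, -b₀ < q →
        IntegrableOn (barnesLK τ b₀ b₁ b₂ q) (Set.Ioi 0) volume ∧
        IntegrableOn (fun x : ℝ => x ^ q) (Set.Ioc 0 1) β ∧
        ∫ x in Set.Ioc 0 1, x ^ q ∂β =
          Real.exp (∫ x in Set.Ioi 0, barnesLK τ b₀ b₁ b₂ q x) := by
  have hprob := isProbabilityMeasure_barnesLogMeasure hτ hb₀ hb₁ hb₂
  have hm : Measurable fun x : ℝ => Real.exp (-x) := by fun_prop
  have hmem : ∀ᵐ y ∂(barnesLogMeasure τ b₀ b₁ b₂).map (fun x => Real.exp (-x)), y ∈ Ioc 0 1 := by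
    refine (ae_map_iff (p := fun y => y ∈ Ioc (0 : ℝ) 1) hm.aemeasurable measurableSet_Ioc).2 ?_
    filter_upwards [ae_nonneg_barnesLogMeasure hτ hb₀ hb₁ hb₂] with x hx
    exact ⟨Real.exp_pos _, by simpa using hx⟩
  refine ⟨(barnesLogMeasure τ b₀ b₁ b₂).map fun x => Real.exp (-x),
    Measure.isProbabilityMeasure_map hm.aemeasurable, hmem, fun q hq =>
    ⟨integrableOn_barnesLK hτ hb₀ hb₁ hb₂ hq, ?_⟩⟩
  have hL := laplaceLIntegral_barnesLogMeasure hτ hb₀ hb₁ hb₂ hq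
  have hpow : Measurable fun x : ℝ => x ^ q := by fun_prop
  have hcomp : (fun x : ℝ => Real.exp (-x) ^ q) = fun x => Real.exp (-(x * q)) := by
    ext x
    rw [← Real.exp_mul, neg_mul]
  rw [IntegrableOn, Measure.restrict_eq_self_of_ae_mem hmem,
    integrable_map_measure hpow.aestronglyMeasurable hm.aemeasurable,
    integral_map hm.aemeasurable hpow.aestronglyMeasurable, Function.comp_def, hcomp,
    integral_eq_lintegral_of_nonneg_ae (ae_of_all _ fun x => Real.exp_nonneg _) (by fun_prop)]
  refine ⟨⟨by fun_prop, ?_⟩, ?_⟩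
  · rw [hasFiniteIntegral_iff_ofReal (ae_of_all _ fun x => Real.exp_nonneg _)]
    exact hL.trans_lt ENNReal.ofReal_lt_top
  · exact (congrArg ENNReal.toReal hL).trans (ENNReal.toReal_ofReal (Real.exp_nonneg _))
end

section
/- For every positive integer n, the infinite product defining 𝔐(−n | μ, λ₁, λ₂) converges and 𝔐(−n | μ, λ₁, λ₂) = ∏_{k=0}^{n−1} [ Γ(2 + λ₁ + λ₂ + (n+2+k)/τ) · Γ(1 − 1/τ) ] / [ Γ(1 + λ₁ + (k+1)/τ) · Γ(1 + λ₂ + (k+1)/τ) · Γ(1 + k/τ) ]. -/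
open MeasureTheory Real

/-- The m-th factor of the infinite product defining 𝔐(q | μ, λ₁, λ₂). -/
noncomputable def MFactor (τ lam₁ lam₂ q : ℝ) (m : ℕ) : ℝ :=
  ((m : ℝ) * τ) ^ (2 * q) *
    (Real.Gamma (1 - q + m * τ) / Real.Gamma (1 + m * τ)) *
    (Real.Gamma (1 - q + τ * lam₁ + m * τ) / Real.Gamma (1 + τ * lam₁ + m * τ)) *
    (Real.Gamma (1 - q + τ * lam₂ + m * τ) / Real.Gamma (1 + τ * lam₂ + m * τ)) *
    (Real.Gamma (2 - q + τ * (lam₁ + lam₂) + m * τ) /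
      Real.Gamma (2 - 2 * q + τ * (lam₁ + lam₂) + m * τ))

/-- The Mellin transform 𝔐(q | μ, λ₁, λ₂) of the Selberg integral distribution,
defined by its (Shintani) infinite-product factorization. -/
noncomputable def MSelberg (τ lam₁ lam₂ q : ℝ) : ℝ :=
  (τ ^ q * Real.Gamma (1 - q / τ) * Real.Gamma (2 - 2 * q + τ * (1 + lam₁ + lam₂))) /
    (Real.Gamma (1 - 1 / τ) ^ q * Real.Gamma (2 - q + τ * (1 + lam₁ + lam₂))) *
    ∏' m : ℕ, MFactor τ lam₁ lam₂ q (m + 1)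

theorem Real.hasProd_of_one_le_of_tendsto_prod_range {f : ℕ → ℝ} {L : ℝ} (hf : ∀ m, 1 ≤ f m) (hL : 0 < L)
    (h : Filter.Tendsto (fun N => ∏ m ∈ Finset.range N, f m) Filter.atTop (nhds L)) :
    HasProd f L := by
  have hpos : ∀ m, 0 < f m := fun m => one_pos.trans_le (hf m)
  have hsum : HasSum (fun m => Real.log (f m)) (Real.log L) := by
    rw [hasSum_iff_tendsto_nat_of_nonneg fun m => Real.log_nonneg (hf m)]
    refine (h.log hL.ne').congr fun N => ?_
    exact Real.log_prod fun m _ => (hpos m).ne'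
  have := hsum.rexp
  rw [Real.exp_log hL] at this
  exact this.congr_fun fun m => by simp [Real.exp_log (hpos m)]

theorem Real.tendsto_prod_one_add_div_mul_rpow {a : ℝ} (ha : 0 < a) :
    Filter.Tendsto (fun N => ∏ m ∈ Finset.range N,
        ((1 + a / ((m : ℝ) + 1)) * (((m : ℝ) + 1) / ((m : ℝ) + 2)) ^ a))
      Filter.atTop (nhds (Real.Gamma (1 + a))⁻¹) := by
  have hprod : ∀ N : ℕ, ∏ m ∈ Finset.range N,
      ((1 + a / ((m : ℝ) + 1)) * (((m : ℝ) + 1) / ((m : ℝ) + 2)) ^ a) =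
      (∏ j ∈ Finset.range (N + 1), (a + j)) / (a * N.factorial) * (1 / ((N : ℝ) + 1)) ^ a := by
    intro N
    induction N with
    | zero => simp [ha.ne']
    | succ N ih =>
      rw [Finset.prod_range_succ, ih, Finset.prod_range_succ _ (N + 1), Nat.factorial_succ]
      have hr : (1 / ((N : ℝ) + 1)) ^ a * (((N : ℝ) + 1) / ((N : ℝ) + 2)) ^ a =
          (1 / (((N + 1 : ℕ) : ℝ) + 1)) ^ a := by
        rw [← Real.mul_rpow (by positivity) (by positivity)]
        congr 1
        push_cast
        field_simp
        ring
      rw [← hr]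
      have hfac : (N.factorial : ℝ) ≠ 0 := by positivity
      push_cast
      field_simp
      ring
  have hratio : Filter.Tendsto (fun N : ℕ => ((N : ℝ) / ((N : ℝ) + 1)) ^ a)
      Filter.atTop (nhds 1) := by
    simpa using (tendsto_natCast_div_add_atTop (1 : ℝ)).rpow_const (p := a) (Or.inl one_ne_zero)
  have hlim := hratio.div ((Real.GammaSeq_tendsto_Gamma a).const_mul a)
    (mul_pos ha (Real.Gamma_pos_of_pos ha)).ne'
  rw [add_comm, Real.Gamma_add_one ha.ne', ← one_div]
  refine hlim.congr' ?_
  filter_upwards [Filter.eventually_gt_atTop 0] with N hN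
  have hN' : (0 : ℝ) < N := by exact_mod_cast hN
  have hne : (∏ j ∈ Finset.range (N + 1), (a + j)) ≠ 0 :=
    Finset.prod_ne_zero_iff.mpr fun j _ => by positivity
  have hNa : (N : ℝ) ^ a ≠ 0 := by positivity
  simp only [Pi.div_apply]
  rw [hprod, Real.GammaSeq, Real.div_rpow hN'.le (by positivity),
    Real.div_rpow zero_le_one (by positivity), Real.one_rpow]
  have hfac : (N.factorial : ℝ) ≠ 0 := by positivity
  field_simp

/-- Euler's infinite product for the reciprocal Gamma function at `1 + a`. -/
theorem Real.hasProd_one_add_div_mul_rpow {a : ℝ} (ha : 0 < a) :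
    HasProd (fun m : ℕ => (1 + a / ((m : ℝ) + 1)) * (((m : ℝ) + 1) / ((m : ℝ) + 2)) ^ a)
      (Real.Gamma (1 + a))⁻¹ := by
  have hG : 0 < Real.Gamma (1 + a) := Real.Gamma_pos_of_pos (by positivity)
  have hlim := Real.tendsto_prod_one_add_div_mul_rpow ha
  have hinv : ∀ m : ℕ, (((m : ℝ) + 1) / ((m : ℝ) + 2)) ^ a =
      ((1 + 1 / ((m : ℝ) + 1)) ^ a)⁻¹ := by
    intro m
    rw [← Real.inv_rpow (by positivity)]
    congr 1
    field_simp
    ring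
  have hs : ∀ m : ℕ, (-1 : ℝ) ≤ 1 / ((m : ℝ) + 1) := fun m =>
    le_trans (by norm_num) (by positivity : (0 : ℝ) ≤ 1 / ((m : ℝ) + 1))
  rcases le_total a 1 with h1 | h1
  · refine Real.hasProd_of_one_le_of_tendsto_prod_range (fun m => ?_) (inv_pos.mpr hG) hlim
    have := rpow_one_add_le_one_add_mul_self (hs m) ha.le h1
    rw [hinv, ← div_eq_mul_inv, one_le_div (by positivity)]
    rwa [mul_one_div] at this
  · have h := Real.hasProd_of_one_le_of_tendsto_prod_range (f := fun m : ℕ =>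
      ((1 + a / ((m : ℝ) + 1)) * (((m : ℝ) + 1) / ((m : ℝ) + 2)) ^ a)⁻¹)
      (fun m => ?_) hG ?_
    · simpa using h.inv₀ hG.ne'
    · have := one_add_mul_self_le_rpow_one_add (hs m) h1
      rw [hinv, ← div_eq_mul_inv, inv_div, one_le_div (by positivity)]
      rwa [mul_one_div] at this
    · simpa only [Finset.prod_inv_distrib, inv_inv] using hlim.inv₀ (inv_pos.mpr hG).ne'

theorem Real.Gamma_add_natCast_eq_prod {x : ℝ} (hx : 0 < x) (n : ℕ) :
    Real.Gamma (x + n) = (∏ k ∈ Finset.range n, (x + k)) * Real.Gamma x := by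
  induction n with
  | zero => simp
  | succ n ih =>
    rw [Finset.prod_range_succ, Nat.cast_succ, ← add_assoc,
      Real.Gamma_add_one (by positivity), ih]
    ring

theorem Finset.sum_range_one_add_two_mul_sub_eq_zero (n : ℕ) :
    ∑ k ∈ Finset.range n, ((1 : ℝ) + 2 * k - n) = 0 := by
  have h : ∀ N : ℕ, ∑ k ∈ Finset.range N, ((1 : ℝ) + 2 * k) = N ^ 2 := by
    intro N
    induction N with
    | zero => simp
    | succ N ih => rw [Finset.sum_range_succ, ih]; push_cast; ring
  rw [Finset.sum_sub_distrib, h]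
  simp [sq]

section

variable {τ lam₁ lam₂ : ℝ}

theorem MFactor_neg_natCast (hτ : 1 < τ) (h₁ : -1 < τ * lam₁) (h₂ : -1 < τ * lam₂) (n m : ℕ) :
    MFactor τ lam₁ lam₂ (-(n : ℝ)) (m + 1) = ∏ k ∈ Finset.range n,
      ((1 + (((k : ℝ) + 1) / τ) / ((m : ℝ) + 1)) *
        (1 + (lam₁ + ((k : ℝ) + 1) / τ) / ((m : ℝ) + 1)) *
        (1 + (lam₂ + ((k : ℝ) + 1) / τ) / ((m : ℝ) + 1)) /
        (1 + (lam₁ + lam₂ + ((n : ℝ) + 2 + k) / τ) / ((m : ℝ) + 1))) := by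
  have hτ0 : 0 < τ := one_pos.trans hτ
  have hM : τ ≤ ((m + 1 : ℕ) : ℝ) * τ := by
    push_cast
    nlinarith [mul_nonneg (Nat.cast_nonneg (α := ℝ) m) hτ0.le]
  have hn : (0 : ℝ) ≤ n := n.cast_nonneg
  have hpow : (((m + 1 : ℕ) : ℝ) * τ) ^ (2 * (-(n : ℝ))) =
      ∏ _k ∈ Finset.range n, ((((m + 1 : ℕ) : ℝ) * τ) ^ 2)⁻¹ := by
    rw [Finset.prod_const, Finset.card_range, mul_neg, Real.rpow_neg (by positivity), inv_pow,
      ← pow_mul, ← Real.rpow_natCast]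
    push_cast
    rfl
  have hGamma : ∀ x : ℝ, 0 < x → Real.Gamma (x + n) / Real.Gamma x =
      ∏ k ∈ Finset.range n, (x + k) := fun x hx => by
    rw [Real.Gamma_add_natCast_eq_prod hx, mul_div_cancel_right₀ _ (Real.Gamma_pos_of_pos hx).ne']
  have hinv : ∀ x : ℝ, 0 < x → Real.Gamma x / Real.Gamma (x + n) =
      ∏ k ∈ Finset.range n, (x + k)⁻¹ := fun x hx => by
    rw [← inv_div, hGamma x hx, Finset.prod_inv_distrib]
  have hτ12 : τ * (lam₁ + lam₂) = τ * lam₁ + τ * lam₂ := by ring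
  have e₁ := hGamma (1 + ((m + 1 : ℕ) : ℝ) * τ) (by linarith)
  have e₂ := hGamma (1 + τ * lam₁ + ((m + 1 : ℕ) : ℝ) * τ) (by linarith)
  have e₃ := hGamma (1 + τ * lam₂ + ((m + 1 : ℕ) : ℝ) * τ) (by linarith)
  have e₄ := hinv (2 + n + τ * (lam₁ + lam₂) + ((m + 1 : ℕ) : ℝ) * τ) (by linarith)
  rw [MFactor, hpow,
    show 1 - -(n : ℝ) + ((m + 1 : ℕ) : ℝ) * τ = 1 + ((m + 1 : ℕ) : ℝ) * τ + n by ring,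
    show 1 - -(n : ℝ) + τ * lam₁ + ((m + 1 : ℕ) : ℝ) * τ =
      1 + τ * lam₁ + ((m + 1 : ℕ) : ℝ) * τ + n by ring,
    show 1 - -(n : ℝ) + τ * lam₂ + ((m + 1 : ℕ) : ℝ) * τ =
      1 + τ * lam₂ + ((m + 1 : ℕ) : ℝ) * τ + n by ring,
    show 2 - -(n : ℝ) + τ * (lam₁ + lam₂) + ((m + 1 : ℕ) : ℝ) * τ =
      2 + n + τ * (lam₁ + lam₂) + ((m + 1 : ℕ) : ℝ) * τ by ring,
    show 2 - 2 * -(n : ℝ) + τ * (lam₁ + lam₂) + ((m + 1 : ℕ) : ℝ) * τ =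
      2 + n + τ * (lam₁ + lam₂) + ((m + 1 : ℕ) : ℝ) * τ + n by ring,
    e₁, e₂, e₃, e₄]
  simp only [← Finset.prod_mul_distrib]
  refine Finset.prod_congr rfl fun k _ => ?_
  have hk : (0 : ℝ) ≤ k := k.cast_nonneg
  have hm : (0 : ℝ) < (m : ℝ) + 1 := by positivity
  have hd : 0 < 2 + n + τ * (lam₁ + lam₂) + ((m : ℝ) + 1) * τ + k := by
    push_cast at hM
    linarith
  have hd' : 1 + (lam₁ + lam₂ + ((n : ℝ) + 2 + k) / τ) / ((m : ℝ) + 1) =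
      (2 + n + τ * (lam₁ + lam₂) + ((m : ℝ) + 1) * τ + k) / (τ * ((m : ℝ) + 1)) := by
    field_simp
    ring
  rw [hd']
  push_cast
  field_simp
  ring

theorem hasProd_MFactor_neg_natCast (hτ : 1 < τ) (h₁ : -1 < τ * lam₁) (h₂ : -1 < τ * lam₂)
    (n : ℕ) :
    HasProd (fun m : ℕ => MFactor τ lam₁ lam₂ (-(n : ℝ)) (m + 1))
      (∏ k ∈ Finset.range n, Real.Gamma (1 + lam₁ + lam₂ + ((n : ℝ) + 2 + k) / τ) /
        (Real.Gamma (1 + ((k : ℝ) + 1) / τ) * Real.Gamma (1 + lam₁ + ((k : ℝ) + 1) / τ) *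
          Real.Gamma (1 + lam₂ + ((k : ℝ) + 1) / τ))) := by
  have hτ0 : 0 < τ := one_pos.trans hτ
  have pos_of : ∀ x : ℝ, 0 < τ * x → 0 < x := fun x hx => pos_of_mul_pos_right hx hτ0.le
  have ha : ∀ k : ℕ, 0 < ((k : ℝ) + 1) / τ := fun k => by positivity
  have ha₁ : ∀ k : ℕ, 0 < lam₁ + ((k : ℝ) + 1) / τ := fun k => pos_of _ <| by
    rw [mul_add, mul_div_cancel₀ _ hτ0.ne']
    linarith [k.cast_nonneg (α := ℝ)]
  have ha₂ : ∀ k : ℕ, 0 < lam₂ + ((k : ℝ) + 1) / τ := fun k => pos_of _ <| by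
    rw [mul_add, mul_div_cancel₀ _ hτ0.ne']
    linarith [k.cast_nonneg (α := ℝ)]
  have hb : ∀ k : ℕ, 0 < lam₁ + lam₂ + ((n : ℝ) + 2 + k) / τ := fun k => pos_of _ <| by
    rw [mul_add, mul_add, mul_div_cancel₀ _ hτ0.ne']
    linarith [k.cast_nonneg (α := ℝ), n.cast_nonneg (α := ℝ)]
  have hG : ∀ {x : ℝ}, 0 < x → Real.Gamma (1 + x) ≠ 0 := fun hx =>
    (Real.Gamma_pos_of_pos (by linarith)).ne'
  have h := hasProd_prod (s := Finset.range n) fun k _ =>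
    (((Real.hasProd_one_add_div_mul_rpow (ha k)).mul
      (Real.hasProd_one_add_div_mul_rpow (ha₁ k))).mul
      (Real.hasProd_one_add_div_mul_rpow (ha₂ k))).div₀
      (Real.hasProd_one_add_div_mul_rpow (hb k)) (inv_ne_zero (hG (hb k)))
  convert! h using 1
  · funext m
    have hu : (0 : ℝ) < ((m : ℝ) + 1) / ((m : ℝ) + 2) := by positivity
    have hone : ∏ k ∈ Finset.range n,
        (((m : ℝ) + 1) / ((m : ℝ) + 2)) ^ (((1 : ℝ) + 2 * k - n) / τ) = 1 := by
      rw [← Real.rpow_sum_of_pos hu, ← Finset.sum_div,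
        Finset.sum_range_one_add_two_mul_sub_eq_zero, zero_div, Real.rpow_zero]
    rw [MFactor_neg_natCast hτ h₁ h₂]
    refine (mul_one _).symm.trans ((congrArg _ hone.symm).trans ?_)
    rw [← Finset.prod_mul_distrib]
    refine Finset.prod_congr rfl fun k _ => ?_
    rw [show ((1 : ℝ) + 2 * k - n) / τ = ((k : ℝ) + 1) / τ + (lam₁ + ((k : ℝ) + 1) / τ) +
        (lam₂ + ((k : ℝ) + 1) / τ) - (lam₁ + lam₂ + ((n : ℝ) + 2 + k) / τ) by ring,
      Real.rpow_sub hu, Real.rpow_add hu, Real.rpow_add hu]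
    simp only [div_mul_div_comm, mul_mul_mul_comm]
  · refine Finset.prod_congr rfl fun k _ => ?_
    simp only [add_assoc, div_eq_mul_inv, mul_inv, inv_inv]
    ring

end

theorem stmt_16 (μ τ lam₁ lam₂ : ℝ) (hμ0 : 0 < μ) (hμ2 : μ < 2) (hτ : τ = 2 / μ)
    (hlam₁ : -μ/2 < lam₁) (hlam₂ : -μ/2 < lam₂)
    (n : ℕ) (hn1 : 1 ≤ n) :
    Multipliable (fun m : ℕ => MFactor τ lam₁ lam₂ (-(n : ℝ)) (m + 1)) ∧
    MSelberg τ lam₁ lam₂ (-(n : ℝ)) =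
      ∏ k ∈ Finset.range n,
        (Real.Gamma (2 + lam₁ + lam₂ + ((n : ℝ) + 2 + k) / τ) * Real.Gamma (1 - 1 / τ)) /
          (Real.Gamma (1 + lam₁ + ((k : ℝ) + 1) / τ) * Real.Gamma (1 + lam₂ + ((k : ℝ) + 1) / τ) *
            Real.Gamma (1 + (k : ℝ) / τ)) := by
  have hτ1 : 1 < τ := by rw [hτ, one_lt_div hμ0]; exact hμ2
  have hτ0 : 0 < τ := one_pos.trans hτ1
  have hμτ : τ * (-μ / 2) = -1 := by rw [hτ]; field_simp
  have h₁ : -1 < τ * lam₁ := hμτ ▸ mul_lt_mul_of_pos_left hlam₁ hτ0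
  have h₂ : -1 < τ * lam₂ := hμτ ▸ mul_lt_mul_of_pos_left hlam₂ hτ0
  have h := hasProd_MFactor_neg_natCast hτ1 h₁ h₂ n
  refine ⟨h.multipliable, ?_⟩
  have hc : 0 < Real.Gamma (1 - 1 / τ) :=
    Real.Gamma_pos_of_pos (sub_pos.mpr ((div_lt_one hτ0).mpr hτ1))
  have hb : ∀ k : ℕ, 0 < 1 + lam₁ + lam₂ + ((n : ℝ) + 2 + k) / τ := fun k => by
    refine pos_of_mul_pos_right (a := τ) ?_ hτ0.le
    rw [mul_add, mul_add, mul_add, mul_div_cancel₀ _ hτ0.ne']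
    linarith [k.cast_nonneg (α := ℝ), n.cast_nonneg (α := ℝ)]
  have hx : 0 < 2 + n + τ * (1 + lam₁ + lam₂) := by
    linarith [n.cast_nonneg (α := ℝ), mul_add τ (1 + lam₁) lam₂, mul_add τ 1 lam₁]
  have hquot : Real.Gamma (2 + n + τ * (1 + lam₁ + lam₂) + n) =
      τ ^ n * (∏ k ∈ Finset.range n, (1 + lam₁ + lam₂ + ((n : ℝ) + 2 + k) / τ)) *
        Real.Gamma (2 + n + τ * (1 + lam₁ + lam₂)) := by
    rw [Real.Gamma_add_natCast_eq_prod hx]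
    congr 1
    conv_rhs => rw [← Finset.card_range n, ← Finset.prod_const, Finset.card_range]
    rw [← Finset.prod_mul_distrib]
    refine Finset.prod_congr rfl fun k _ => ?_
    field_simp
    ring
  have hshift : Real.Gamma (1 + n / τ) * ∏ k ∈ Finset.range n, Real.Gamma (1 + (k : ℝ) / τ) =
      ∏ k ∈ Finset.range n, Real.Gamma (1 + ((k : ℝ) + 1) / τ) := by
    have := Finset.prod_range_succ (fun k : ℕ => Real.Gamma (1 + (k : ℝ) / τ)) n
    rw [Finset.prod_range_succ'] at this
    simpa [mul_comm] using this.symm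
  have hne : ∀ k : ℕ, Real.Gamma (1 + (k : ℝ) / τ) ≠ 0 := fun k =>
    (Real.Gamma_pos_of_pos (by positivity)).ne'
  have hP : ∏ k ∈ Finset.range n, Real.Gamma (1 + (k : ℝ) / τ) ≠ 0 :=
    Finset.prod_ne_zero_iff.mpr fun k _ => hne k
  have hprod : ∀ k ∈ Finset.range n, Real.Gamma (2 + lam₁ + lam₂ + ((n : ℝ) + 2 + k) / τ) =
      (1 + lam₁ + lam₂ + ((n : ℝ) + 2 + k) / τ) *
        Real.Gamma (1 + lam₁ + lam₂ + ((n : ℝ) + 2 + k) / τ) := fun k _ => by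
    rw [← Real.Gamma_add_one (hb k).ne']
    congr 1
    ring
  have hGx := (Real.Gamma_pos_of_pos hx).ne'
  have hGn : Real.Gamma (1 + n / τ) ≠ 0 := hne n
  rw [MSelberg, h.tprod_eq,
    show 2 - 2 * -(n : ℝ) + τ * (1 + lam₁ + lam₂) = 2 + n + τ * (1 + lam₁ + lam₂) + n by ring,
    show 2 - -(n : ℝ) + τ * (1 + lam₁ + lam₂) = 2 + n + τ * (1 + lam₁ + lam₂) by ring,
    show 1 - -(n : ℝ) / τ = 1 + n / τ by ring, hquot, Real.rpow_neg hτ0.le, Real.rpow_neg hc.le,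
    Real.rpow_natCast, Real.rpow_natCast]
  simp only [Finset.prod_div_distrib, Finset.prod_mul_distrib, Finset.prod_const,
    Finset.card_range]
  rw [Finset.prod_congr rfl hprod, Finset.prod_mul_distrib, ← hshift]
  field_simp
end
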